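/- The second and third Chevalley–Eilenberg cohomology spaces of g_{−1} with coefficients in the adjoint module both have dimension 2: dim H^2(g_{−1},g_{−1}) = 2, with the classes of the cocycles φ_1 and φ_2 forming a basis, and dim H^3(g_{−1},g_{−1}) = 2. -/

import Mathlib

/-- The underlying space `ℝ⁸` of the family `g_α`. -/
abbrev V8 : Type := Fin 8 → ℝ

/-- The standard basis vector `X_{k+1}` (0-indexed: `e8 k`). -/
def e8 (k : Fin 8) : V8 := fun l => if l = k then 1 else 0

/-- Brackets of basis elements of `g_α` for `i < j` (0-indexed, `X_{i+1} = e8 i`):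
`u α i j = [X_{i+1}, X_{j+1}]`. -/
noncomputable def gUpper (α : ℝ) : Fin 8 → Fin 8 → V8 := fun i j =>
  match (i : ℕ), (j : ℕ) with
  | 0, 1 => (2 : ℝ) • e8 1          -- [X₁,X₂] = 2X₂
  | 0, 2 => (-2 : ℝ) • e8 2         -- [X₁,X₃] = −2X₃
  | 1, 2 => e8 0                    -- [X₂,X₃] = X₁
  | 0, 3 => e8 3                    -- [X₁,X₄] = X₄
  | 0, 4 => -e8 4                   -- [X₁,X₅] = −X₅
  | 0, 5 => e8 5                    -- [X₁,X₆] = X₆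
  | 0, 6 => -e8 6                   -- [X₁,X₇] = −X₇
  | 1, 4 => e8 3                    -- [X₂,X₅] = X₄
  | 1, 6 => e8 5                    -- [X₂,X₇] = X₆
  | 2, 3 => e8 4                    -- [X₃,X₄] = X₅
  | 2, 5 => e8 6                    -- [X₃,X₆] = X₇
  | 3, 7 => e8 3                    -- [X₄,X₈] = X₄
  | 4, 7 => e8 4                    -- [X₅,X₈] = X₅
  | 5, 7 => α • e8 5                -- [X₆,X₈] = αX₆
  | 6, 7 => α • e8 6                -- [X₇,X₈] = αX₇
  | _, _ => 0

/-- The structure constants `C_{ij}^k` of `g_α`. -/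
noncomputable def gC (α : ℝ) (i j k : Fin 8) : ℝ := gUpper α i j k - gUpper α j i k

/-- The bilinear map on `ℝ⁸` with structure constants `C`. -/
noncomputable def brOf (C : Fin 8 → Fin 8 → Fin 8 → ℝ) : V8 →ₗ[ℝ] V8 →ₗ[ℝ] V8 :=
  LinearMap.mk₂ ℝ (fun x y k => ∑ i, ∑ j, C i j k * x i * y j)
    (by
      intro x x' y
      funext k
      simp only [Pi.add_apply]
      rw [← Finset.sum_add_distrib]
      refine Finset.sum_congr rfl fun i _ => ?_
      rw [← Finset.sum_add_distrib]
      exact Finset.sum_congr rfl fun j _ => by ring)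
    (by
      intro c x y
      funext k
      simp only [Pi.smul_apply, smul_eq_mul]
      rw [Finset.mul_sum]
      refine Finset.sum_congr rfl fun i _ => ?_
      rw [Finset.mul_sum]
      exact Finset.sum_congr rfl fun j _ => by ring)
    (by
      intro x y y'
      funext k
      simp only [Pi.add_apply]
      rw [← Finset.sum_add_distrib]
      refine Finset.sum_congr rfl fun i _ => ?_
      rw [← Finset.sum_add_distrib]
      exact Finset.sum_congr rfl fun j _ => by ring)
    (by
      intro c x y
      funext k
      simp only [Pi.smul_apply, smul_eq_mul]
      rw [Finset.mul_sum]
      refine Finset.sum_congr rfl fun i _ => ?_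
      rw [Finset.mul_sum]
      exact Finset.sum_congr rfl fun j _ => by ring)

/-- The Lie bracket `μ_α` of the Lie algebra `g_α`, as a bilinear map on `ℝ⁸`. -/
noncomputable def brA (α : ℝ) : V8 →ₗ[ℝ] V8 →ₗ[ℝ] V8 := brOf (gC α)

/-- Values `φ₁(X_{i+1}, X_{j+1})` for `i < j` (0-indexed). -/
noncomputable def phi1Upper : Fin 8 → Fin 8 → V8 := fun i j =>
  match (i : ℕ), (j : ℕ) with
  | 3, 5 => e8 1                                        -- φ₁(X₄,X₆) = X₂
  | 3, 6 => (-(1:ℝ)/2) • e8 0 + ((3:ℝ)/2) • e8 7        -- φ₁(X₄,X₇) = −½X₁+³⁄₂X₈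
  | 4, 5 => (-(1:ℝ)/2) • e8 0 - ((3:ℝ)/2) • e8 7        -- φ₁(X₅,X₆) = −½X₁−³⁄₂X₈
  | 4, 6 => -e8 2                                       -- φ₁(X₅,X₇) = −X₃
  | _, _ => 0

/-- The alternating bilinear map `φ₁` on `ℝ⁸`. -/
noncomputable def phi1 : V8 →ₗ[ℝ] V8 →ₗ[ℝ] V8 :=
  brOf (fun i j k => phi1Upper i j k - phi1Upper j i k)

/-- Values `φ₂(X_{i+1}, X_{j+1})` for `i < j` (0-indexed). -/
noncomputable def phi2Upper : Fin 8 → Fin 8 → V8 := fun i j =>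
  match (i : ℕ), (j : ℕ) with
  | 5, 7 => e8 5                                        -- φ₂(X₆,X₈) = X₆
  | 6, 7 => e8 6                                        -- φ₂(X₇,X₈) = X₇
  | _, _ => 0

/-- The alternating bilinear map `φ₂` on `ℝ⁸`. -/
noncomputable def phi2 : V8 →ₗ[ℝ] V8 →ₗ[ℝ] V8 :=
  brOf (fun i j k => phi2Upper i j k - phi2Upper j i k)

open Filter Topology Set

namespace CE

variable {V W : Type} [AddCommGroup V] [Module ℝ V] [AddCommGroup W] [Module ℝ W]

/-- The Chevalley–Eilenberg coboundary of a `p`-cochain `Φ` (an alternating `p`-linear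
map `V^p → W`), relative to a bracket `br` on `V` and an action `ρ` of `V` on `W`,
evaluated on a `(p+1)`-tuple `X` (indices `0,…,p` correspond to `X_1,…,X_{p+1}`):
`dΦ(X_0,…,X_p) = Σ_s (−1)^s ρ(X_s)(Φ(…,X̂_s,…))
  + Σ_{s<t} (−1)^{s+t} Φ(br(X_s,X_t),…,X̂_s,…,X̂_t,…)`. -/
def ceDfun (br : V →ₗ[ℝ] V →ₗ[ℝ] V) (ρ : V →ₗ[ℝ] W →ₗ[ℝ] W) {p : ℕ}
    (Φ : V [⋀^Fin p]→ₗ[ℝ] W) (X : Fin (p + 1) → V) : W :=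
  (∑ s : Fin (p + 1), ((-1 : ℝ) ^ (s : ℕ)) • ρ (X s) (Φ (X ∘ s.succAbove)))
  + ∑ s : Fin (p + 1), ∑ t : Fin (p + 1),
      if (s : ℕ) < (t : ℕ) then
        ((-1 : ℝ) ^ ((s : ℕ) + (t : ℕ))) • Φ (fun i : Fin p =>
          if (i : ℕ) = 0 then br (X s) (X t)
          else if (i : ℕ) - 1 < (s : ℕ) then X ⟨(i : ℕ) - 1, by have := i.isLt; omega⟩
          else if (i : ℕ) < (t : ℕ) then X ⟨(i : ℕ), by have := i.isLt; omega⟩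
          else X ⟨(i : ℕ) + 1, by have := i.isLt; omega⟩)
      else 0

/-- The Chevalley–Eilenberg coboundary, as a linear map into functions. -/
def ceD (br : V →ₗ[ℝ] V →ₗ[ℝ] V) (ρ : V →ₗ[ℝ] W →ₗ[ℝ] W) (p : ℕ) :
    (V [⋀^Fin p]→ₗ[ℝ] W) →ₗ[ℝ] ((Fin (p + 1) → V) → W) where
  toFun Φ := ceDfun br ρ Φ
  map_add' Φ Ψ := by
    have key : ∀ {c : Prop} [Decidable c] (a b : W),
        (if c then a + b else 0) = (if c then a else 0) + (if c then b else 0) := by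
      intro c _ a b; split <;> simp
    funext X
    simp only [ceDfun, AlternatingMap.add_apply, map_add, smul_add, Pi.add_apply,
      key, Finset.sum_add_distrib]
    abel
  map_smul' c Φ := by
    funext X
    simp only [ceDfun, AlternatingMap.smul_apply, map_smul, RingHom.id_apply, Pi.smul_apply,
      smul_add, Finset.smul_sum, smul_ite, smul_zero, smul_smul, mul_comm]

/-- Evaluation of an alternating map as a plain function, as a linear map. -/
def altEval (q : ℕ) : (V [⋀^Fin q]→ₗ[ℝ] W) →ₗ[ℝ] ((Fin q → V) → W) where
  toFun Ψ := ⇑Ψ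
  map_add' a b := by funext X; simp
  map_smul' c a := by funext X; simp

/-- The space `Z^p` of `p`-cocycles. -/
def ceZ (br : V →ₗ[ℝ] V →ₗ[ℝ] V) (ρ : V →ₗ[ℝ] W →ₗ[ℝ] W) (p : ℕ) :
    Submodule ℝ (V [⋀^Fin p]→ₗ[ℝ] W) :=
  LinearMap.ker (ceD br ρ p)

/-- The space `B^p` of `p`-coboundaries (`B^0 = 0`). -/
def ceB (br : V →ₗ[ℝ] V →ₗ[ℝ] V) (ρ : V →ₗ[ℝ] W →ₗ[ℝ] W) :
    (p : ℕ) → Submodule ℝ (V [⋀^Fin p]→ₗ[ℝ] W)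
  | 0 => ⊥
  | (p + 1) => Submodule.comap (altEval (p + 1)) (LinearMap.range (ceD br ρ p))

/-- The `p`-th Chevalley–Eilenberg cohomology space `H^p = Z^p / B^p`. -/
def CEH (br : V →ₗ[ℝ] V →ₗ[ℝ] V) (ρ : V →ₗ[ℝ] W →ₗ[ℝ] W) (p : ℕ) : Type :=
  ceZ br ρ p ⧸ Submodule.comap (ceZ br ρ p).subtype (ceB br ρ p)

noncomputable instance (br : V →ₗ[ℝ] V →ₗ[ℝ] V) (ρ : V →ₗ[ℝ] W →ₗ[ℝ] W) (p : ℕ) :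
    AddCommGroup (CEH br ρ p) :=
  inferInstanceAs (AddCommGroup (ceZ br ρ p ⧸ Submodule.comap (ceZ br ρ p).subtype (ceB br ρ p)))

noncomputable instance (br : V →ₗ[ℝ] V →ₗ[ℝ] V) (ρ : V →ₗ[ℝ] W →ₗ[ℝ] W) (p : ℕ) :
    Module ℝ (CEH br ρ p) :=
  inferInstanceAs (Module ℝ (ceZ br ρ p ⧸ Submodule.comap (ceZ br ρ p).subtype (ceB br ρ p)))

/-- `dim H^p`. -/
noncomputable def Hdim (br : V →ₗ[ℝ] V →ₗ[ℝ] V) (ρ : V →ₗ[ℝ] W →ₗ[ℝ] W) (p : ℕ) : ℕ :=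
  Module.finrank ℝ (CEH br ρ p)

end CE

namespace CE
variable {V W : Type} [AddCommGroup V] [Module ℝ V] [AddCommGroup W] [Module ℝ W]

/-- The cohomology class of a cocycle. -/
def CEHcls (br : V →ₗ[ℝ] V →ₗ[ℝ] V) (ρ : V →ₗ[ℝ] W →ₗ[ℝ] W) (p : ℕ)
    (z : ceZ br ρ p) : CEH br ρ p :=
  (Submodule.comap (ceZ br ρ p).subtype (ceB br ρ p)).mkQ z

end CE

/-- Build an alternating 2-linear map from an alternating bilinear map. -/
def alt2 {V W : Type} [AddCommGroup V] [Module ℝ V] [AddCommGroup W] [Module ℝ W]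
    (B : V →ₗ[ℝ] V →ₗ[ℝ] W) (hB : ∀ x, B x x = 0) : V [⋀^Fin 2]→ₗ[ℝ] W where
  toFun v := B (v 0) (v 1)
  map_update_add' := by
    intro dec v i x y
    fin_cases i <;> simp [Function.update_apply]
  map_update_smul' := by
    intro dec v i c x
    fin_cases i <;> simp [Function.update_apply]
  map_eq_zero_of_eq' := by
    intro v i j hij hne
    fin_cases i <;> fin_cases j
    · exact absurd rfl hne
    · show B (v 0) (v 1) = 0
      rw [show v 0 = v 1 from hij]
      exact hB _
    · show B (v 0) (v 1) = 0
      rw [show v 1 = v 0 from hij]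
      exact hB _
    · exact absurd rfl hne

lemma brOf_alt (C : Fin 8 → Fin 8 → Fin 8 → ℝ) (hC : ∀ i j k, C j i k = -C i j k)
    (x : V8) : brOf C x x = 0 := by
  funext k
  show (∑ i, ∑ j, C i j k * x i * x j) = 0
  have h : (∑ i, ∑ j, C i j k * x i * x j) = -∑ i, ∑ j, C i j k * x i * x j := by
    calc (∑ i, ∑ j, C i j k * x i * x j)
        = ∑ j, ∑ i, C i j k * x i * x j := Finset.sum_comm
      _ = ∑ a, ∑ b, -(C a b k * x a * x b) :=
          Finset.sum_congr rfl fun a _ => Finset.sum_congr rfl fun b _ => by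
            rw [hC a b k]; ring
      _ = -∑ i, ∑ j, C i j k * x i * x j := by
          simp [Finset.sum_neg_distrib]
  linarith

/-- `φ₁` as an alternating 2-linear map on `ℝ⁸`. -/
noncomputable def phi1Alt : V8 [⋀^Fin 2]→ₗ[ℝ] V8 :=
  alt2 phi1 (brOf_alt _ (fun i j k => by show _ - _ = -(_ - _); ring))

/-- `φ₂` as an alternating 2-linear map on `ℝ⁸`. -/
noncomputable def phi2Alt : V8 [⋀^Fin 2]→ₗ[ℝ] V8 :=
  alt2 phi2 (brOf_alt _ (fun i j k => by show _ - _ = -(_ - _); ring))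

namespace CE

section Explicit
variable {V W : Type} [AddCommGroup V] [Module ℝ V] [AddCommGroup W] [Module ℝ W]
  (br : V →ₗ[ℝ] V →ₗ[ℝ] V) (ρ : V →ₗ[ℝ] W →ₗ[ℝ] W)

lemma ceDfun_one (Φ : V [⋀^Fin 1]→ₗ[ℝ] W) (X : Fin 2 → V) :
    ceDfun br ρ Φ X = ρ (X 0) (Φ ![X 1]) - ρ (X 1) (Φ ![X 0]) - Φ ![br (X 0) (X 1)] := by
  have h0 : X ∘ Fin.succ = ![X 1] := by ext i; fin_cases i; rfl
  have h1 : X ∘ Fin.succAbove 1 = ![X 0] := by ext i; fin_cases i; rfl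
  have h2 : (fun _ : Fin 1 => br (X 0) (X 1)) = ![br (X 0) (X 1)] := by ext i; fin_cases i; rfl
  simp [ceDfun, Fin.sum_univ_succ, h0, h1, h2]
  module

lemma ceDfun_two (Φ : V [⋀^Fin 2]→ₗ[ℝ] W) (X : Fin 3 → V) :
    ceDfun br ρ Φ X = ρ (X 0) (Φ ![X 1, X 2]) - ρ (X 1) (Φ ![X 0, X 2])
      + ρ (X 2) (Φ ![X 0, X 1]) - Φ ![br (X 0) (X 1), X 2] + Φ ![br (X 0) (X 2), X 1]
      - Φ ![br (X 1) (X 2), X 0] := by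
  rw [ceDfun]
  have h0 : X ∘ Fin.succ = ![X 1, X 2] := by ext i; fin_cases i <;> rfl
  have h1 : X ∘ Fin.succAbove 1 = ![X 0, X 2] := by ext i; fin_cases i <;> rfl
  have h2 : X ∘ Fin.succAbove 2 = ![X 0, X 1] := by ext i; fin_cases i <;> rfl
  have g : ∀ (f : Fin 2 → V), f = ![f 0, f 1] := by
    intro f; ext i; fin_cases i <;> rfl
  conv_lhs => enter [2, 2, s, 2, t]; rw [g (fun i : Fin 2 => _)]
  simp [Fin.sum_univ_three, h0, h1, h2]
  module

lemma ceDfun_three (Φ : V [⋀^Fin 3]→ₗ[ℝ] W) (X : Fin 4 → V) :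
    ceDfun br ρ Φ X = ρ (X 0) (Φ ![X 1, X 2, X 3]) - ρ (X 1) (Φ ![X 0, X 2, X 3])
      + ρ (X 2) (Φ ![X 0, X 1, X 3]) - ρ (X 3) (Φ ![X 0, X 1, X 2])
      - Φ ![br (X 0) (X 1), X 2, X 3] + Φ ![br (X 0) (X 2), X 1, X 3]
      - Φ ![br (X 0) (X 3), X 1, X 2] - Φ ![br (X 1) (X 2), X 0, X 3]
      + Φ ![br (X 1) (X 3), X 0, X 2] - Φ ![br (X 2) (X 3), X 0, X 1] := by
  rw [ceDfun]
  have h0 : X ∘ Fin.succ = ![X 1, X 2, X 3] := by ext i; fin_cases i <;> rfl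
  have h1 : X ∘ Fin.succAbove 1 = ![X 0, X 2, X 3] := by ext i; fin_cases i <;> rfl
  have h2 : X ∘ Fin.succAbove 2 = ![X 0, X 1, X 3] := by ext i; fin_cases i <;> rfl
  have h3 : X ∘ Fin.succAbove 3 = ![X 0, X 1, X 2] := by ext i; fin_cases i <;> rfl
  have g : ∀ (f : Fin 3 → V), f = ![f 0, f 1, f 2] := by
    intro f; ext i; fin_cases i <;> rfl
  conv_lhs => enter [2, 2, s, 2, t]; rw [g (fun i : Fin 3 => _)]
  simp [Fin.sum_univ_four, h0, h1, h2, h3]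
  module

lemma alt_two_swap (Φ : V [⋀^Fin 2]→ₗ[ℝ] W) (a b : V) : Φ ![a, b] = -Φ ![b, a] := by
  rw [← Φ.map_swap ![b, a] (show (0 : Fin 2) ≠ 1 by decide)]
  congr 1
  ext i; fin_cases i <;> rfl

lemma alt_three_swap_left (Φ : V [⋀^Fin 3]→ₗ[ℝ] W) (a b c : V) :
    Φ ![a, b, c] = -Φ ![b, a, c] := by
  rw [← Φ.map_swap ![b, a, c] (show (0 : Fin 3) ≠ 1 by decide)]
  congr 1
  ext i; fin_cases i <;> rfl

lemma alt_three_swap_right (Φ : V [⋀^Fin 3]→ₗ[ℝ] W) (a b c : V) :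
    Φ ![a, b, c] = -Φ ![a, c, b] := by
  rw [← Φ.map_swap ![a, c, b] (show (1 : Fin 3) ≠ 2 by decide)]
  congr 1
  ext i; fin_cases i <;> rfl

lemma alt_two_self (Φ : V [⋀^Fin 2]→ₗ[ℝ] W) (a : V) : Φ ![a, a] = 0 :=
  Φ.map_eq_zero_of_eq _ (i := 0) (j := 1) rfl (by decide)

lemma alt_three_left (Φ : V [⋀^Fin 3]→ₗ[ℝ] W) (a b : V) : Φ ![a, a, b] = 0 :=
  Φ.map_eq_zero_of_eq _ (i := 0) (j := 1) rfl (by decide)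

lemma alt_three_right (Φ : V [⋀^Fin 3]→ₗ[ℝ] W) (a b : V) : Φ ![b, a, a] = 0 :=
  Φ.map_eq_zero_of_eq _ (i := 1) (j := 2) rfl (by decide)

lemma multi_one_add (Φ : V [⋀^Fin 1]→ₗ[ℝ] W) (a b : V) :
    Φ ![a + b] = Φ ![a] + Φ ![b] := Φ.map_vecCons_add ..

lemma multi_one_smul (Φ : V [⋀^Fin 1]→ₗ[ℝ] W) (c : ℝ) (a : V) :
    Φ ![c • a] = c • Φ ![a] := Φ.map_vecCons_smul ..

lemma multi_two_add_left (Φ : V [⋀^Fin 2]→ₗ[ℝ] W) (a b c : V) :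
    Φ ![a + b, c] = Φ ![a, c] + Φ ![b, c] := Φ.map_vecCons_add ..

lemma multi_two_smul_left (Φ : V [⋀^Fin 2]→ₗ[ℝ] W) (r : ℝ) (a c : V) :
    Φ ![r • a, c] = r • Φ ![a, c] := Φ.map_vecCons_smul ..

lemma multi_two_add_right (Φ : V [⋀^Fin 2]→ₗ[ℝ] W) (a b c : V) :
    Φ ![c, a + b] = Φ ![c, a] + Φ ![c, b] := by
  rw [alt_two_swap, multi_two_add_left, alt_two_swap Φ a, alt_two_swap Φ b]; abel

lemma multi_two_smul_right (Φ : V [⋀^Fin 2]→ₗ[ℝ] W) (r : ℝ) (a c : V) :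
    Φ ![c, r • a] = r • Φ ![c, a] := by
  rw [alt_two_swap, multi_two_smul_left, alt_two_swap Φ a]; module

lemma multi_three_add_left (Φ : V [⋀^Fin 3]→ₗ[ℝ] W) (a b c d : V) :
    Φ ![a + b, c, d] = Φ ![a, c, d] + Φ ![b, c, d] := Φ.map_vecCons_add ..

lemma multi_three_smul_left (Φ : V [⋀^Fin 3]→ₗ[ℝ] W) (r : ℝ) (a c d : V) :
    Φ ![r • a, c, d] = r • Φ ![a, c, d] := Φ.map_vecCons_smul ..

lemma multi_three_add_mid (Φ : V [⋀^Fin 3]→ₗ[ℝ] W) (a b c d : V) :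
    Φ ![c, a + b, d] = Φ ![c, a, d] + Φ ![c, b, d] := by
  rw [alt_three_swap_left, multi_three_add_left, alt_three_swap_left Φ a,
    alt_three_swap_left Φ b]; abel

lemma multi_three_smul_mid (Φ : V [⋀^Fin 3]→ₗ[ℝ] W) (r : ℝ) (a c d : V) :
    Φ ![c, r • a, d] = r • Φ ![c, a, d] := by
  rw [alt_three_swap_left, multi_three_smul_left, alt_three_swap_left Φ a]; module

lemma multi_three_add_right (Φ : V [⋀^Fin 3]→ₗ[ℝ] W) (a b c d : V) :
    Φ ![c, d, a + b] = Φ ![c, d, a] + Φ ![c, d, b] := by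
  rw [alt_three_swap_right, multi_three_add_mid, alt_three_swap_right Φ c a,
    alt_three_swap_right Φ c b]; abel

lemma multi_three_smul_right (Φ : V [⋀^Fin 3]→ₗ[ℝ] W) (r : ℝ) (a c d : V) :
    Φ ![c, d, r • a] = r • Φ ![c, d, a] := by
  rw [alt_three_swap_right, multi_three_smul_mid, alt_three_swap_right Φ c a]; module

/-- The coboundary of a `1`-cochain as an alternating map. -/
def coboundaryOne (hbr : ∀ a, br a a = 0) (Φ : V [⋀^Fin 1]→ₗ[ℝ] W) : V [⋀^Fin 2]→ₗ[ℝ] W where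
  toFun := ceDfun br ρ Φ
  map_update_add' := by
    intro inst X i x y
    obtain rfl : inst = instDecidableEqFin 2 := Subsingleton.elim _ _
    fin_cases i <;>
      simp [ceDfun_one, multi_one_add] <;> module
  map_update_smul' := by
    intro inst X i c x
    obtain rfl : inst = instDecidableEqFin 2 := Subsingleton.elim _ _
    fin_cases i <;>
      simp [ceDfun_one, multi_one_smul] <;> module
  map_eq_zero_of_eq' := by
    intro X i j h hij
    have h0 : Φ ![(0 : V)] = 0 := by simpa using multi_one_smul Φ 0 0
    have : X 1 = X 0 := by
      fin_cases i <;> fin_cases j <;> first | exact h | exact h.symm | exact absurd rfl hij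
    simp [ceDfun_one, this, hbr, h0]

/-- The coboundary of a `2`-cochain as an alternating map. -/
def coboundaryTwo (hbr : ∀ a, br a a = 0) (Φ : V [⋀^Fin 2]→ₗ[ℝ] W) : V [⋀^Fin 3]→ₗ[ℝ] W where
  toFun := ceDfun br ρ Φ
  map_update_add' := by
    intro inst X i x y
    obtain rfl : inst = instDecidableEqFin 3 := Subsingleton.elim _ _
    fin_cases i <;>
      simp [ceDfun_two, multi_two_add_left, multi_two_add_right] <;> module
  map_update_smul' := by
    intro inst X i c x
    obtain rfl : inst = instDecidableEqFin 3 := Subsingleton.elim _ _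
    fin_cases i <;>
      simp [ceDfun_two, multi_two_smul_left, multi_two_smul_right] <;> module
  map_eq_zero_of_eq' := by
    intro X i j h hij
    have hsw : ∀ a b, br a b = -br b a := fun a b => by
      have := hbr (a + b)
      simp only [map_add, LinearMap.add_apply, hbr, zero_add, add_zero] at this
      exact eq_neg_of_add_eq_zero_right this
    have h0 : ∀ a, Φ ![(0 : V), a] = 0 := fun a => by simpa using multi_two_smul_left Φ 0 0 a
    have hn : ∀ a b, Φ ![-a, b] = -Φ ![a, b] := fun a b => by
      simpa using multi_two_smul_left Φ (-1) a b
    have : X 1 = X 0 ∨ X 2 = X 0 ∨ X 2 = X 1 := by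
      fin_cases i <;> fin_cases j <;> first | exact absurd rfl hij | (simp at h; simp [h])
    rcases this with h | h | h <;>
      simp [ceDfun_two, h, hbr, h0, hn, alt_two_self, alt_two_swap Φ (X 1) (X 0),
        hsw (X 1) (X 0)]

/-- The coboundary of a `3`-cochain as an alternating map. -/
def coboundaryThree (hbr : ∀ a, br a a = 0) (Φ : V [⋀^Fin 3]→ₗ[ℝ] W) :
    V [⋀^Fin 4]→ₗ[ℝ] W where
  toFun := ceDfun br ρ Φ
  map_update_add' := by
    intro inst X i x y
    obtain rfl : inst = instDecidableEqFin 4 := Subsingleton.elim _ _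
    fin_cases i <;>
      simp [ceDfun_three, multi_three_add_left, multi_three_add_mid,
        multi_three_add_right] <;> module
  map_update_smul' := by
    intro inst X i c x
    obtain rfl : inst = instDecidableEqFin 4 := Subsingleton.elim _ _
    fin_cases i <;>
      simp [ceDfun_three, multi_three_smul_left, multi_three_smul_mid,
        multi_three_smul_right] <;> module
  map_eq_zero_of_eq' := by
    intro X i j h hij
    have hsw : ∀ a b, br a b = -br b a := fun a b => by
      have := hbr (a + b)
      simp only [map_add, LinearMap.add_apply, hbr, zero_add, add_zero] at this
      exact eq_neg_of_add_eq_zero_right this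
    have h0 : ∀ a b, Φ ![(0 : V), a, b] = 0 := fun a b => by
      simpa using multi_three_smul_left Φ 0 0 a b
    have hn : ∀ a b c, Φ ![-a, b, c] = -Φ ![a, b, c] := fun a b c => by
      simpa using multi_three_smul_left Φ (-1) a b c
    have : X 1 = X 0 ∨ X 2 = X 0 ∨ X 2 = X 1 ∨ X 3 = X 0 ∨ X 3 = X 1 ∨ X 3 = X 2 := by
      fin_cases i <;> fin_cases j <;> first | exact absurd rfl hij | (simp at h; simp [h])
    rcases this with h | h | h | h | h | h <;>
      simp [ceDfun_three, h, hbr, h0, hn, alt_three_left, alt_three_right,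
        alt_three_swap_left Φ (X 1) (X 0), alt_three_swap_right Φ _ (X 1) (X 0),
        alt_three_swap_right Φ _ (X 2) (X 0), alt_three_swap_right Φ _ (X 2) (X 1),
        hsw (X 1) (X 0), hsw (X 2) (X 0), hsw (X 2) (X 1)]

end Explicit
end CE

open CE

lemma e8_eq_single (k : Fin 8) : e8 k = Pi.single k 1 := by
  ext l; simp [e8, Pi.single_apply]

/-- Alternating maps on `ℝ⁸` agree once they agree on increasing tuples of basis vectors. -/
lemma alternating_ext_strictMono {n : ℕ} {W : Type} [AddCommGroup W] [Module ℝ W]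
    {f g : V8 [⋀^Fin n]→ₗ[ℝ] W}
    (h : ∀ v : Fin n → Fin 8, StrictMono v → f (e8 ∘ v) = g (e8 ∘ v)) : f = g := by
  refine Module.Basis.ext_alternating (Pi.basisFun ℝ (Fin 8)) fun v hv => ?_
  have hs : StrictMono (v ∘ Tuple.sort v) :=
    (Tuple.monotone_sort v).strictMono_of_injective (hv.comp (Tuple.sort v).injective)
  have hb : (fun i => Pi.basisFun ℝ (Fin 8) (v i)) = e8 ∘ v := by
    funext i; simp [e8_eq_single]
  have h1 := h _ hs
  rw [← Function.comp_assoc, f.map_perm, g.map_perm] at h1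
  rw [hb]
  exact MulAction.injective _ h1

lemma alternating_sum_apply {ι : Type} (s : Finset ι) {p : ℕ} (f : ι → V8 [⋀^Fin p]→ₗ[ℝ] V8)
    (X : Fin p → V8) : (∑ i ∈ s, f i) X = ∑ i ∈ s, f i X := by
  classical
  induction s using Finset.induction_on with
  | empty => simp
  | insert a s ha ih => rw [Finset.sum_insert ha, Finset.sum_insert ha, AlternatingMap.add_apply, ih]

/-- The alternating map whose coefficient at each basis tuple is that of `Φ`, rescaled by `g`. -/
noncomputable def rescale {p : ℕ} (g : (Fin p → Fin 8) → Fin 8 → ℝ) (Φ : V8 [⋀^Fin p]→ₗ[ℝ] V8) :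
    V8 [⋀^Fin p]→ₗ[ℝ] V8 :=
  ∑ v : Fin p → Fin 8, ((p.factorial : ℝ)⁻¹) •
    (Matrix.detRowAlternating.compLinearMap (LinearMap.funLeft ℝ ℝ v)).smulRight
      (fun l => g v l * Φ (e8 ∘ v) l)

lemma det_minor_e8 {p : ℕ} (u v : Fin p → Fin 8) :
    Matrix.detRowAlternating.compLinearMap (LinearMap.funLeft ℝ ℝ v) (e8 ∘ u)
      = ∑ σ : Equiv.Perm (Fin p), if v = u ∘ σ then ((Equiv.Perm.sign σ : ℤ) : ℝ) else 0 := by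
  rw [AlternatingMap.compLinearMap_apply]
  change Matrix.det (Matrix.of fun i => LinearMap.funLeft ℝ ℝ v ((e8 ∘ u) i)) = _
  rw [Matrix.det_apply]
  refine Finset.sum_congr rfl fun σ _ => ?_
  split_ifs with h
  · subst h
    simp [LinearMap.funLeft_apply, e8, Units.smul_def]
  · obtain ⟨a, ha⟩ := Function.ne_iff.mp h
    rw [Finset.prod_eq_zero (Finset.mem_univ a), smul_zero]
    simpa [LinearMap.funLeft_apply, e8] using ha

lemma rescale_apply {p : ℕ} (g : (Fin p → Fin 8) → Fin 8 → ℝ)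
    (hg : ∀ (v : Fin p → Fin 8) (σ : Equiv.Perm (Fin p)), g (v ∘ σ) = g v)
    (Φ : V8 [⋀^Fin p]→ₗ[ℝ] V8) (u : Fin p → Fin 8) (l : Fin 8) :
    rescale g Φ (e8 ∘ u) l = g u l * Φ (e8 ∘ u) l := by
  have key : ∀ σ : Equiv.Perm (Fin p), ((Equiv.Perm.sign σ : ℤ) : ℝ) *
      (g (u ∘ σ) l * Φ (e8 ∘ (u ∘ σ)) l) = g u l * Φ (e8 ∘ u) l := fun σ => by
    rw [hg, ← Function.comp_assoc, Φ.map_perm]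
    rcases Int.units_eq_one_or (Equiv.Perm.sign σ) with h | h <;> simp [h]
  have hf : (p.factorial : ℝ) ≠ 0 := by positivity
  rw [rescale, alternating_sum_apply]
  simp only [ AlternatingMap.smul_apply,
    AlternatingMap.smulRight_apply, Finset.sum_apply, Pi.smul_apply, smul_eq_mul, det_minor_e8,
    Finset.sum_mul, Finset.mul_sum]
  rw [Finset.sum_comm]
  simp only [ite_mul, zero_mul, mul_ite, mul_zero, Finset.sum_ite_eq',
    Finset.mem_univ, if_true, key]
  simp [Fintype.card_perm, hf]

/-- The integers `s` with `[X_i, X_j] = s X_t` in `g_{-1}`. -/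
def bracketCoeff : Fin 8 → Fin 8 → ℤ :=
  ![![0, 2, -2, 1, -1, 1, -1, 0],
    ![-2, 0, 1, 0, 1, 0, 1, 0],
    ![2, -1, 0, 1, 0, 1, 0, 0],
    ![-1, 0, -1, 0, 0, 0, 0, 1],
    ![1, -1, 0, 0, 0, 0, 0, 1],
    ![-1, 0, -1, 0, 0, 0, 0, -1],
    ![1, -1, 0, 0, 0, 0, 0, -1],
    ![0, 0, 0, -1, -1, 1, 1, 0]]

/-- The indices `t` with `[X_i, X_j] = s X_t` in `g_{-1}`. -/
def bracketIndex : Fin 8 → Fin 8 → Fin 8 :=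
  ![![0, 1, 2, 3, 4, 5, 6, 0],
    ![1, 0, 0, 0, 3, 0, 5, 0],
    ![2, 0, 0, 4, 0, 6, 0, 0],
    ![3, 0, 4, 0, 0, 0, 0, 3],
    ![4, 3, 0, 0, 0, 0, 0, 4],
    ![5, 0, 6, 0, 0, 0, 0, 5],
    ![6, 5, 0, 0, 0, 0, 0, 6],
    ![0, 0, 0, 3, 4, 5, 6, 0]]

/-- The eigenvalues of `ad (X_1 + 10 X_8)`. -/
def weight : Fin 8 → ℤ := ![0, 2, -2, -9, -11, 11, 9, 0]

lemma weight_bracket (i j : Fin 8) (h : bracketCoeff i j ≠ 0) :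
    weight (bracketIndex i j) = weight i + weight j := by
  revert i j; decide

lemma brOf_e8 (C : Fin 8 → Fin 8 → Fin 8 → ℝ) (i j : Fin 8) : brOf C (e8 i) (e8 j) = C i j := by
  funext k
  change (∑ a, ∑ b, C a b k * e8 i a * e8 j b) = _
  simp [e8]

lemma brA_e8 (i j : Fin 8) :
    brA (-1) (e8 i) (e8 j) = (bracketCoeff i j : ℝ) • e8 (bracketIndex i j) := by
  rw [brA, brOf_e8]
  funext k
  fin_cases i <;> fin_cases j <;> simp [gC, gUpper, bracketCoeff, bracketIndex]

lemma sum_smul_e8 (y : V8) : ∑ m, y m • e8 m = y := by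
  funext l; simp [e8]

lemma brA_e8_apply (i : Fin 8) (y : V8) (l : Fin 8) :
    brA (-1) (e8 i) y l
      = ∑ m, if bracketIndex i m = l then (bracketCoeff i m : ℝ) * y m else 0 := by
  conv_lhs => rw [← sum_smul_e8 y]
  simp only [map_sum, map_smul, brA_e8, Finset.sum_apply, Pi.smul_apply, smul_eq_mul]
  refine Finset.sum_congr rfl fun m _ => ?_
  simp only [e8, eq_comm (a := l)]
  split_ifs <;> ring

lemma brA_self (x : V8) : brA (-1) x x = 0 :=
  brOf_alt _ (fun i j k => by simp only [gC]; ring) x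

/-- The element `X_1 + 10 X_8`. -/
noncomputable def gradingElement : V8 := e8 0 + (10 : ℝ) • e8 7

lemma brA_gradingElement_e8 (i : Fin 8) :
    brA (-1) gradingElement (e8 i) = (weight i : ℝ) • e8 i := by
  simp only [gradingElement, map_add, map_smul, LinearMap.add_apply, LinearMap.smul_apply, brA_e8]
  fin_cases i <;> simp [bracketCoeff, bracketIndex, weight] <;> module

lemma brA_gradingElement_apply (y : V8) (l : Fin 8) :
    brA (-1) gradingElement y l = weight l * y l := by
  conv_lhs => rw [← sum_smul_e8 y]
  simp only [map_sum, map_smul, brA_gradingElement_e8, Finset.sum_apply, Pi.smul_apply,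
    smul_eq_mul]
  simp [e8, mul_comm]

lemma e8_comp_one (i : Fin 8) : e8 ∘ ![i] = ![e8 i] := by
  ext a : 1; fin_cases a; rfl

lemma e8_comp_two (i j : Fin 8) : e8 ∘ ![i, j] = ![e8 i, e8 j] := by
  ext a : 1; fin_cases a <;> rfl

lemma e8_comp_three (i j k : Fin 8) : e8 ∘ ![i, j, k] = ![e8 i, e8 j, e8 k] := by
  ext a : 1; fin_cases a <;> rfl

lemma e8_comp_four (i j k m : Fin 8) : e8 ∘ ![i, j, k, m] = ![e8 i, e8 j, e8 k, e8 m] := by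
  ext a : 1; fin_cases a <;> rfl

/-- Rescaling of the coefficients of a cochain by a function of their weight. -/
noncomputable def weightScale {p : ℕ} (f : ℤ → ℝ) (Φ : V8 [⋀^Fin p]→ₗ[ℝ] V8) :
    V8 [⋀^Fin p]→ₗ[ℝ] V8 :=
  rescale (fun v l => f (weight l - ∑ a, weight (v a))) Φ

lemma weightScale_apply {p : ℕ} (f : ℤ → ℝ) (Φ : V8 [⋀^Fin p]→ₗ[ℝ] V8) (u : Fin p → Fin 8)
    (l : Fin 8) :
    weightScale f Φ (e8 ∘ u) l = f (weight l - ∑ a, weight (u a)) * Φ (e8 ∘ u) l := by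
  refine rescale_apply _ (fun v σ => ?_) Φ u l
  funext l
  simp only [Function.comp_apply, Equiv.sum_comp σ (fun a => weight (v a))]

lemma weightScale_one (f : ℤ → ℝ) (Φ : V8 [⋀^Fin 1]→ₗ[ℝ] V8) (i l : Fin 8) :
    weightScale f Φ ![e8 i] l = f (weight l - weight i) * Φ ![e8 i] l := by
  simpa [e8_comp_one] using weightScale_apply f Φ ![i] l

lemma weightScale_two (f : ℤ → ℝ) (Φ : V8 [⋀^Fin 2]→ₗ[ℝ] V8) (i j l : Fin 8) :
    weightScale f Φ ![e8 i, e8 j] l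
      = f (weight l - (weight i + weight j)) * Φ ![e8 i, e8 j] l := by
  simpa [e8_comp_two] using weightScale_apply f Φ ![i, j] l

lemma brA_e8_scaled (f : ℤ → ℝ) (i : Fin 8) (x : ℤ) (y z : V8)
    (h : ∀ m, y m = f (weight m - x) * z m) (l : Fin 8) :
    brA (-1) (e8 i) y l = f (weight l - (weight i + x)) * brA (-1) (e8 i) z l := by
  rw [brA_e8_apply, brA_e8_apply, Finset.mul_sum]
  refine Finset.sum_congr rfl fun m _ => ?_
  split_ifs with hm
  · by_cases h0 : bracketCoeff i m = 0
    · simp [h0]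
    · rw [h, ← hm, weight_bracket i m h0, add_sub_add_left_eq_sub]; ring
  · simp

lemma bracketCoeff_mul_scaled (f : ℤ → ℝ) (i j : Fin 8) (x : ℤ) (c : ℤ) :
    (bracketCoeff i j : ℝ) * f (c - (weight (bracketIndex i j) + x))
      = bracketCoeff i j * f (c - (weight i + weight j + x)) := by
  by_cases h0 : bracketCoeff i j = 0
  · simp [h0]
  · rw [weight_bracket i j h0]

/-- The coboundary operator of `g_{-1}` on adjoint `1`-cochains. -/
noncomputable abbrev dOne (Φ : V8 [⋀^Fin 1]→ₗ[ℝ] V8) : V8 [⋀^Fin 2]→ₗ[ℝ] V8 :=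
  coboundaryOne (brA (-1)) (brA (-1)) brA_self Φ

/-- The coboundary operator of `g_{-1}` on adjoint `2`-cochains. -/
noncomputable abbrev dTwo (Φ : V8 [⋀^Fin 2]→ₗ[ℝ] V8) : V8 [⋀^Fin 3]→ₗ[ℝ] V8 :=
  coboundaryTwo (brA (-1)) (brA (-1)) brA_self Φ

/-- The coboundary operator of `g_{-1}` on adjoint `3`-cochains. -/
noncomputable abbrev dThree (Φ : V8 [⋀^Fin 3]→ₗ[ℝ] V8) : V8 [⋀^Fin 4]→ₗ[ℝ] V8 :=
  coboundaryThree (brA (-1)) (brA (-1)) brA_self Φ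

lemma dOne_apply (Φ : V8 [⋀^Fin 1]→ₗ[ℝ] V8) (a b : V8) :
    dOne Φ ![a, b] = brA (-1) a (Φ ![b]) - brA (-1) b (Φ ![a]) - Φ ![brA (-1) a b] :=
  ceDfun_one _ _ Φ ![a, b]

lemma dTwo_apply (Φ : V8 [⋀^Fin 2]→ₗ[ℝ] V8) (a b c : V8) :
    dTwo Φ ![a, b, c] = brA (-1) a (Φ ![b, c]) - brA (-1) b (Φ ![a, c]) + brA (-1) c (Φ ![a, b])
      - Φ ![brA (-1) a b, c] + Φ ![brA (-1) a c, b] - Φ ![brA (-1) b c, a] :=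
  ceDfun_two _ _ Φ ![a, b, c]

lemma dThree_apply (Φ : V8 [⋀^Fin 3]→ₗ[ℝ] V8) (a b c d : V8) :
    dThree Φ ![a, b, c, d] = brA (-1) a (Φ ![b, c, d]) - brA (-1) b (Φ ![a, c, d])
      + brA (-1) c (Φ ![a, b, d]) - brA (-1) d (Φ ![a, b, c])
      - Φ ![brA (-1) a b, c, d] + Φ ![brA (-1) a c, b, d] - Φ ![brA (-1) a d, b, c]
      - Φ ![brA (-1) b c, a, d] + Φ ![brA (-1) b d, a, c] - Φ ![brA (-1) c d, a, b] :=
  ceDfun_three _ _ Φ ![a, b, c, d]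

lemma dOne_weightScale (f : ℤ → ℝ) (Φ : V8 [⋀^Fin 1]→ₗ[ℝ] V8) (i j l : Fin 8) :
    dOne (weightScale f Φ) ![e8 i, e8 j] l
      = f (weight l - (weight i + weight j)) * dOne Φ ![e8 i, e8 j] l := by
  have h2 := bracketCoeff_mul_scaled f i j 0 (weight l)
  simp only [dOne_apply, brA_e8, multi_one_smul, Pi.sub_apply, Pi.smul_apply, smul_eq_mul,
    brA_e8_scaled f i (weight j) _ _ (weightScale_one f Φ j),
    brA_e8_scaled f j (weight i) _ _ (weightScale_one f Φ i), weightScale_one]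
  rw [add_comm (weight j) (weight i)]
  simp only [add_zero] at h2
  linear_combination -(Φ ![e8 (bracketIndex i j)] l) * h2

lemma dTwo_weightScale (f : ℤ → ℝ) (Φ : V8 [⋀^Fin 2]→ₗ[ℝ] V8) (i j k l : Fin 8) :
    dTwo (weightScale f Φ) ![e8 i, e8 j, e8 k] l
      = f (weight l - (weight i + weight j + weight k)) * dTwo Φ ![e8 i, e8 j, e8 k] l := by
  have h1 := bracketCoeff_mul_scaled f i j (weight k) (weight l)
  have h2 := bracketCoeff_mul_scaled f i k (weight j) (weight l)
  have h3 := bracketCoeff_mul_scaled f j k (weight i) (weight l)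
  simp only [dTwo_apply, brA_e8, multi_two_smul_left, Pi.sub_apply, Pi.add_apply, Pi.smul_apply,
    smul_eq_mul, brA_e8_scaled f i (weight j + weight k) _ _ (weightScale_two f Φ j k),
    brA_e8_scaled f j (weight i + weight k) _ _ (weightScale_two f Φ i k),
    brA_e8_scaled f k (weight i + weight j) _ _ (weightScale_two f Φ i j), weightScale_two]
  rw [show weight i + (weight j + weight k) = weight i + weight j + weight k by ring,
    show weight j + (weight i + weight k) = weight i + weight j + weight k by ring,
    show weight k + (weight i + weight j) = weight i + weight j + weight k by ring]
  rw [show weight i + weight k + weight j = weight i + weight j + weight k by ring] at h2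
  rw [show weight j + weight k + weight i = weight i + weight j + weight k by ring] at h3
  linear_combination -(Φ ![e8 (bracketIndex i j), e8 k] l) * h1
    + (Φ ![e8 (bracketIndex i k), e8 j] l) * h2 - (Φ ![e8 (bracketIndex j k), e8 i] l) * h3

lemma dOne_curryLeft_gradingElement (Φ : V8 [⋀^Fin 2]→ₗ[ℝ] V8) (hΦ : dTwo Φ = 0)
    (i j l : Fin 8) :
    dOne (Φ.curryLeft gradingElement) ![e8 i, e8 j] l
      = ((weight l - (weight i + weight j) : ℤ) : ℝ) * Φ ![e8 i, e8 j] l := by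
  have h := congrFun (DFunLike.congr_fun hΦ ![gradingElement, e8 i, e8 j]) l
  have hc : ∀ x, Φ.curryLeft gradingElement ![x] = Φ ![gradingElement, x] := fun _ => rfl
  simp only [dTwo_apply, brA_gradingElement_e8, multi_two_smul_left, Pi.sub_apply, Pi.add_apply,
    Pi.smul_apply, smul_eq_mul, brA_gradingElement_apply, AlternatingMap.zero_apply,
    Pi.zero_apply, alt_two_swap Φ _ gradingElement, Pi.neg_apply,
    alt_two_swap Φ (e8 j) (e8 i)] at h
  simp only [dOne_apply, hc, Pi.sub_apply]
  push_cast
  linear_combination -h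

lemma dTwo_curryLeft_gradingElement (Φ : V8 [⋀^Fin 3]→ₗ[ℝ] V8) (hΦ : dThree Φ = 0)
    (i j k l : Fin 8) :
    dTwo (Φ.curryLeft gradingElement) ![e8 i, e8 j, e8 k] l
      = ((weight l - (weight i + weight j + weight k) : ℤ) : ℝ) * Φ ![e8 i, e8 j, e8 k] l := by
  have h := congrFun (DFunLike.congr_fun hΦ ![gradingElement, e8 i, e8 j, e8 k]) l
  have hc : ∀ x y, Φ.curryLeft gradingElement ![x, y] = Φ ![gradingElement, x, y] :=
    fun _ _ => rfl
  simp only [dThree_apply, brA_gradingElement_e8, multi_three_smul_left, Pi.sub_apply,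
    Pi.add_apply, Pi.smul_apply, smul_eq_mul, brA_gradingElement_apply, AlternatingMap.zero_apply,
    Pi.zero_apply, alt_three_swap_left Φ _ gradingElement, Pi.neg_apply,
    alt_three_swap_left Φ (e8 j) (e8 i), alt_three_swap_left Φ (e8 k) (e8 i),
    alt_three_swap_right Φ _ (e8 k) (e8 j)] at h
  simp only [dTwo_apply, hc, Pi.sub_apply, Pi.add_apply]
  push_cast
  linear_combination -h

/-- A cocycle is cohomologous to its weight-zero part, and coboundaries can be prescribed on the
weight-zero part. -/
lemma exists_dOne_eq (Φ : V8 [⋀^Fin 2]→ₗ[ℝ] V8) (hΦ : dTwo Φ = 0) (K : V8 [⋀^Fin 1]→ₗ[ℝ] V8) :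
    ∃ Ψ, ∀ i j l, dOne Ψ ![e8 i, e8 j] l =
      if weight l - (weight i + weight j) = 0 then dOne K ![e8 i, e8 j] l
      else Φ ![e8 i, e8 j] l := by
  refine ⟨weightScale (fun x => (x : ℝ)⁻¹) (Φ.curryLeft gradingElement)
    + weightScale (fun x => if x = 0 then 1 else 0) K, fun i j l => ?_⟩
  have hadd : ∀ A B : V8 [⋀^Fin 1]→ₗ[ℝ] V8, dOne (A + B) = dOne A + dOne B := fun A B => by
    ext1 X; exact congrFun ((ceD (brA (-1)) (brA (-1)) 1).map_add A B) X
  rw [hadd, AlternatingMap.add_apply, Pi.add_apply, dOne_weightScale, dOne_weightScale,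
    dOne_curryLeft_gradingElement Φ hΦ]
  split_ifs with h
  · simp [h]
  · rw [inv_mul_cancel_left₀ (Int.cast_ne_zero.mpr h)]; ring

/-- A cocycle is cohomologous to its weight-zero part, and coboundaries can be prescribed on the
weight-zero part. -/
lemma exists_dTwo_eq (Φ : V8 [⋀^Fin 3]→ₗ[ℝ] V8) (hΦ : dThree Φ = 0)
    (K : V8 [⋀^Fin 2]→ₗ[ℝ] V8) :
    ∃ Ψ, ∀ i j k l, dTwo Ψ ![e8 i, e8 j, e8 k] l =
      if weight l - (weight i + weight j + weight k) = 0 then dTwo K ![e8 i, e8 j, e8 k] l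
      else Φ ![e8 i, e8 j, e8 k] l := by
  refine ⟨weightScale (fun x => (x : ℝ)⁻¹) (Φ.curryLeft gradingElement)
    + weightScale (fun x => if x = 0 then 1 else 0) K, fun i j k l => ?_⟩
  have hadd : ∀ A B : V8 [⋀^Fin 2]→ₗ[ℝ] V8, dTwo (A + B) = dTwo A + dTwo B := fun A B => by
    ext1 X; exact congrFun ((ceD (brA (-1)) (brA (-1)) 2).map_add A B) X
  rw [hadd, AlternatingMap.add_apply, Pi.add_apply, dTwo_weightScale, dTwo_weightScale,
    dTwo_curryLeft_gradingElement Φ hΦ]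
  split_ifs with h
  · simp [h]
  · rw [inv_mul_cancel_left₀ (Int.cast_ne_zero.mpr h)]; ring

section Evaluation
variable (y : V8)

lemma brA_e8_zero : brA (-1) (e8 0) y = ![0, 2 * y 1, -2 * y 2, y 3, -y 4, y 5, -y 6, 0] := by
  funext l; fin_cases l <;> simp [brA_e8_apply, Fin.sum_univ_eight, bracketCoeff, bracketIndex]

lemma brA_e8_one : brA (-1) (e8 1) y = ![y 2, -2 * y 0, 0, y 4, 0, y 6, 0, 0] := by
  funext l; fin_cases l <;> simp [brA_e8_apply, Fin.sum_univ_eight, bracketCoeff, bracketIndex]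

lemma brA_e8_two : brA (-1) (e8 2) y = ![-y 1, 0, 2 * y 0, 0, y 3, 0, y 5, 0] := by
  funext l; fin_cases l <;> simp [brA_e8_apply, Fin.sum_univ_eight, bracketCoeff, bracketIndex]

lemma brA_e8_three : brA (-1) (e8 3) y = ![0, 0, 0, y 7 - y 0, -y 2, 0, 0, 0] := by
  funext l; fin_cases l <;> simp [brA_e8_apply, Fin.sum_univ_eight, bracketCoeff, bracketIndex]
  ring

lemma brA_e8_four : brA (-1) (e8 4) y = ![0, 0, 0, -y 1, y 0 + y 7, 0, 0, 0] := by
  funext l; fin_cases l <;> simp [brA_e8_apply, Fin.sum_univ_eight, bracketCoeff, bracketIndex]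

lemma brA_e8_five : brA (-1) (e8 5) y = ![0, 0, 0, 0, 0, -y 0 - y 7, -y 2, 0] := by
  funext l; fin_cases l <;> simp [brA_e8_apply, Fin.sum_univ_eight, bracketCoeff, bracketIndex]
  ring

lemma brA_e8_six : brA (-1) (e8 6) y = ![0, 0, 0, 0, 0, -y 1, y 0 - y 7, 0] := by
  funext l; fin_cases l <;> simp [brA_e8_apply, Fin.sum_univ_eight, bracketCoeff, bracketIndex]
  ring

lemma brA_e8_seven : brA (-1) (e8 7) y = ![0, 0, 0, -y 3, -y 4, y 5, y 6, 0] := by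
  funext l; fin_cases l <;> simp [brA_e8_apply, Fin.sum_univ_eight, bracketCoeff, bracketIndex]

end Evaluation

lemma alt_two_sort (Φ : V8 [⋀^Fin 2]→ₗ[ℝ] V8) {i j : Fin 8} (_ : j < i) :
    Φ ![e8 i, e8 j] = -Φ ![e8 j, e8 i] := alt_two_swap ..

lemma alt_three_sort_left (Φ : V8 [⋀^Fin 3]→ₗ[ℝ] V8) {i j : Fin 8} (_ : j < i) (k : Fin 8) :
    Φ ![e8 i, e8 j, e8 k] = -Φ ![e8 j, e8 i, e8 k] := alt_three_swap_left ..

lemma alt_three_sort_right (Φ : V8 [⋀^Fin 3]→ₗ[ℝ] V8) {i j : Fin 8} (_ : j < i) (k : Fin 8) :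
    Φ ![e8 k, e8 i, e8 j] = -Φ ![e8 k, e8 j, e8 i] := alt_three_swap_right ..

/-- The linear map sending the basis vectors to the rows of `M`, as a `1`-cochain. -/
noncomputable def oneCochain (M : Fin 8 → V8) : V8 [⋀^Fin 1]→ₗ[ℝ] V8 :=
  AlternatingMap.ofSubsingleton ℝ V8 V8 0 (Fintype.linearCombination ℝ M)

lemma oneCochain_e8 (M : Fin 8 → V8) (i : Fin 8) : oneCochain M ![e8 i] = M i := by
  change Fintype.linearCombination ℝ M (e8 i) = M i
  rw [e8_eq_single, Fintype.linearCombination_apply_single, one_smul]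

/-- The `2`-cochain with values `U i j` on the pairs `X_i, X_j` with `i < j`, provided `U` vanishes
on all other pairs. -/
noncomputable def twoCochain (U : Fin 8 → Fin 8 → V8) : V8 [⋀^Fin 2]→ₗ[ℝ] V8 :=
  alt2 (brOf fun i j k => U i j k - U j i k) (brOf_alt _ fun i j k => by ring)

lemma twoCochain_e8 (U : Fin 8 → Fin 8 → V8) (i j : Fin 8) :
    twoCochain U ![e8 i, e8 j] = U i j - U j i := by
  funext k
  exact congrFun (brOf_e8 (fun i j k => U i j k - U j i k) i j) k

lemma phi1Alt_e8 (i j : Fin 8) : phi1Alt ![e8 i, e8 j] = phi1Upper i j - phi1Upper j i :=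
  twoCochain_e8 phi1Upper i j

lemma phi2Alt_e8 (i j : Fin 8) : phi2Alt ![e8 i, e8 j] = phi2Upper i j - phi2Upper j i :=
  twoCochain_e8 phi2Upper i j


/-- The action of a basis vector of `g_{-1}` on integral vectors. -/
def intAct (i : Fin 8) (c : Fin 8 → ℤ) (l : Fin 8) : ℤ :=
  ∑ m, if bracketIndex i m = l then bracketCoeff i m * c m else 0

lemma brA_e8_intCast (i : Fin 8) (y : V8) (r : ℝ) (c : Fin 8 → ℤ) (h : ∀ m, y m = r * c m)
    (l : Fin 8) :
    brA (-1) (e8 i) y l = r * intAct i c l := by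
  rw [brA_e8_apply, intAct, Int.cast_sum, Finset.mul_sum]
  refine Finset.sum_congr rfl fun m _ => ?_
  rw [h]
  split_ifs
  · push_cast; ring
  · simp

/-- The coboundary of an integral `2`-cochain. -/
def intDTwo (c : Fin 8 → Fin 8 → Fin 8 → ℤ) (i j k l : Fin 8) : ℤ :=
  intAct i (c j k) l - intAct j (c i k) l + intAct k (c i j) l
    - bracketCoeff i j * c (bracketIndex i j) k l + bracketCoeff i k * c (bracketIndex i k) j l
    - bracketCoeff j k * c (bracketIndex j k) i l

/-- The coboundary of an integral `3`-cochain. -/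
def intDThree (c : Fin 8 → Fin 8 → Fin 8 → Fin 8 → ℤ) (i j k m l : Fin 8) : ℤ :=
  intAct i (c j k m) l - intAct j (c i k m) l + intAct k (c i j m) l - intAct m (c i j k) l
    - bracketCoeff i j * c (bracketIndex i j) k m l + bracketCoeff i k * c (bracketIndex i k) j m l
    - bracketCoeff i m * c (bracketIndex i m) j k l - bracketCoeff j k * c (bracketIndex j k) i m l
    + bracketCoeff j m * c (bracketIndex j m) i k l - bracketCoeff k m * c (bracketIndex k m) i j l

lemma dTwo_eq_zero_of_int (Φ : V8 [⋀^Fin 2]→ₗ[ℝ] V8) (r : ℝ) (c : Fin 8 → Fin 8 → Fin 8 → ℤ)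
    (h : ∀ i j l, Φ ![e8 i, e8 j] l = r * c i j l)
    (hc : ∀ i j k, i < j → j < k → ∀ l, intDTwo c i j k l = 0) : dTwo Φ = 0 := by
  refine alternating_ext_strictMono fun v hv => ?_
  obtain ⟨i, j, k, rfl⟩ : ∃ i j k, v = ![i, j, k] :=
    ⟨v 0, v 1, v 2, by ext a; fin_cases a <;> rfl⟩
  funext l
  have h0 := congrArg (Int.cast : ℤ → ℝ) (hc i j k (hv (show (0 : Fin 3) < 1 by decide))
    (hv (show (1 : Fin 3) < 2 by decide)) l)
  rw [intDTwo] at h0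
  push_cast at h0
  simp only [e8_comp_three, dTwo_apply, brA_e8, multi_two_smul_left, Pi.sub_apply, Pi.add_apply,
    Pi.smul_apply, smul_eq_mul, brA_e8_intCast _ _ r _ (h _ _), h,
    AlternatingMap.zero_apply, Pi.zero_apply]
  linear_combination r * h0

lemma dThree_eq_zero_of_int (Φ : V8 [⋀^Fin 3]→ₗ[ℝ] V8) (r : ℝ)
    (c : Fin 8 → Fin 8 → Fin 8 → Fin 8 → ℤ)
    (h : ∀ i j k l, Φ ![e8 i, e8 j, e8 k] l = r * c i j k l)
    (hc : ∀ i j k m, i < j → j < k → k < m → ∀ l, intDThree c i j k m l = 0) : dThree Φ = 0 := by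
  refine alternating_ext_strictMono fun v hv => ?_
  obtain ⟨i, j, k, m, rfl⟩ : ∃ i j k m, v = ![i, j, k, m] :=
    ⟨v 0, v 1, v 2, v 3, by ext a; fin_cases a <;> rfl⟩
  funext l
  have h0 := congrArg (Int.cast : ℤ → ℝ) (hc i j k m (hv (show (0 : Fin 4) < 1 by decide))
    (hv (show (1 : Fin 4) < 2 by decide)) (hv (show (2 : Fin 4) < 3 by decide)) l)
  rw [intDThree] at h0
  push_cast at h0
  simp only [e8_comp_four, dThree_apply, brA_e8, multi_three_smul_left, Pi.sub_apply, Pi.add_apply,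
    Pi.smul_apply, smul_eq_mul, brA_e8_intCast _ _ r _ (h _ _ _), h,
    AlternatingMap.zero_apply, Pi.zero_apply]
  linear_combination r * h0

/-- Twice the coefficients of `φ₁` on increasing pairs of basis vectors. -/
def phi1Int (i j l : Fin 8) : ℤ :=
  match (i : ℕ), (j : ℕ), (l : ℕ) with
  | 3, 5, 1 => 2
  | 3, 6, 0 => -1
  | 3, 6, 7 => 3
  | 4, 5, 0 => -1
  | 4, 5, 7 => -3
  | 4, 6, 2 => -2
  | _, _, _ => 0

/-- The coefficients of `φ₂` on increasing pairs of basis vectors. -/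
def phi2Int (i j l : Fin 8) : ℤ :=
  match (i : ℕ), (j : ℕ), (l : ℕ) with
  | 5, 7, 5 => 1
  | 6, 7, 6 => 1
  | _, _, _ => 0

lemma phi1Upper_eq (i j l : Fin 8) : phi1Upper i j l = (1 / 2 : ℝ) * phi1Int i j l := by
  fin_cases i <;> fin_cases j <;> first
    | simp [phi1Upper, phi1Int]; done
    | fin_cases l <;> norm_num [phi1Upper, phi1Int, e8] <;> decide

lemma phi2Upper_eq (i j l : Fin 8) : phi2Upper i j l = (1 : ℝ) * phi2Int i j l := by
  fin_cases i <;> fin_cases j <;> first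
    | simp [phi2Upper, phi2Int]; done
    | fin_cases l <;> simp [phi2Upper, phi2Int, e8]

lemma dTwo_phi1Alt : dTwo phi1Alt = 0 := by
  refine dTwo_eq_zero_of_int _ (1 / 2) (fun i j l => phi1Int i j l - phi1Int j i l)
    (fun i j l => ?_) (by decide +kernel)
  rw [phi1Alt_e8, Pi.sub_apply, phi1Upper_eq, phi1Upper_eq]
  push_cast; ring

lemma dTwo_phi2Alt : dTwo phi2Alt = 0 := by
  refine dTwo_eq_zero_of_int _ 1 (fun i j l => phi2Int i j l - phi2Int j i l)
    (fun i j l => ?_) (by decide +kernel)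
  rw [phi2Alt_e8, Pi.sub_apply, phi2Upper_eq, phi2Upper_eq]
  push_cast; ring

/-- The `3`-cochain obtained by antisymmetrizing the integral coefficients `U`. -/
noncomputable def threeCochain (U : Fin 8 → Fin 8 → Fin 8 → Fin 8 → ℤ) :
    V8 [⋀^Fin 3]→ₗ[ℝ] V8 :=
  ∑ v : Fin 3 → Fin 8, (Matrix.detRowAlternating.compLinearMap
    (LinearMap.funLeft ℝ ℝ v)).smulRight (fun l => (U (v 0) (v 1) (v 2) l : ℝ))

/-- The coefficients of `threeCochain U`. -/
def antisymmetrize (U : Fin 8 → Fin 8 → Fin 8 → Fin 8 → ℤ) (i j k l : Fin 8) : ℤ :=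
  U i j k l - U i k j l - U j i k l + U j k i l + U k i j l - U k j i l

lemma threeCochain_e8 (U : Fin 8 → Fin 8 → Fin 8 → Fin 8 → ℤ) (i j k l : Fin 8) :
    threeCochain U ![e8 i, e8 j, e8 k] l = antisymmetrize U i j k l := by
  have hs : ∀ f : Equiv.Perm (Fin 3) → ℝ, ∑ σ, f σ = f 1 + f (Equiv.swap 1 2) + f (Equiv.swap 0 1)
      + f (Equiv.swap 0 1 * Equiv.swap 1 2) + f (Equiv.swap 1 2 * Equiv.swap 0 1)
      + f (Equiv.swap 0 2) := fun f => by
    rw [show (Finset.univ : Finset (Equiv.Perm (Fin 3))) = {1, Equiv.swap 1 2, Equiv.swap 0 1,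
      Equiv.swap 0 1 * Equiv.swap 1 2, Equiv.swap 1 2 * Equiv.swap 0 1, Equiv.swap 0 2} by decide]
    repeat rw [Finset.sum_insert (by decide)]
    rw [Finset.sum_singleton]; ring
  rw [← e8_comp_three, threeCochain, alternating_sum_apply]
  simp only [AlternatingMap.smulRight_apply, Finset.sum_apply, Pi.smul_apply, smul_eq_mul,
    det_minor_e8, Finset.sum_mul]
  rw [Finset.sum_comm]
  simp only [ite_mul, zero_mul, Finset.sum_ite_eq', Finset.mem_univ, if_true, hs]
  simp [antisymmetrize, Equiv.swap_apply_def]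
  ring

/-- The coefficients of the `3`-cocycle `2 φ₁ ∧ ξ⁸`, where `ξ⁸` is dual to `X_8`. -/
def psi1Int (i j k l : Fin 8) : ℤ := if k = 7 then phi1Int i j l else 0

/-- The coefficients of a `3`-cocycle independent of `φ₁ ∧ ξ⁸` in cohomology. -/
def psi2Int (i j k l : Fin 8) : ℤ :=
  match (i : ℕ), (j : ℕ), (k : ℕ), (l : ℕ) with
  | 3, 4, 5, 3 => 1
  | 3, 4, 6, 4 => 1
  | _, _, _, _ => 0

lemma dThree_psi1 : dThree (threeCochain psi1Int) = 0 :=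
  dThree_eq_zero_of_int _ 1 (antisymmetrize psi1Int) (fun i j k l => by rw [threeCochain_e8, one_mul])
    (by decide +kernel)

lemma dThree_psi2 : dThree (threeCochain psi2Int) = 0 :=
  dThree_eq_zero_of_int _ 1 (antisymmetrize psi2Int) (fun i j k l => by rw [threeCochain_e8, one_mul])
    (by decide +kernel)

lemma phi1Alt_e8_apply (i j l : Fin 8) :
    phi1Alt ![e8 i, e8 j] l = (1 / 2 : ℝ) * (phi1Int i j l - phi1Int j i l : ℤ) := by
  rw [phi1Alt_e8, Pi.sub_apply, phi1Upper_eq, phi1Upper_eq]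
  push_cast; ring

lemma phi2Alt_e8_apply (i j l : Fin 8) :
    phi2Alt ![e8 i, e8 j] l = (phi2Int i j l - phi2Int j i l : ℤ) := by
  rw [phi2Alt_e8, Pi.sub_apply, phi2Upper_eq, phi2Upper_eq]
  push_cast; ring

/-- Every `2`-cocycle of `g_{-1}` is a combination of `φ₁` and `φ₂` up to a coboundary. -/
lemma exists_eq_dOne_add (Φ : V8 [⋀^Fin 2]→ₗ[ℝ] V8) (hΦ : dTwo Φ = 0) :
    ∃ (Ψ : V8 [⋀^Fin 1]→ₗ[ℝ] V8) (s t : ℝ), Φ = dOne Ψ + s • phi1Alt + t • phi2Alt := by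
  obtain ⟨Ψ, hΨ⟩ := exists_dOne_eq Φ hΦ (oneCochain
    ![![-(1 / 2) * Φ ![e8 0, e8 2] 2, 0, 0, 0, 0, 0, 0, -Φ ![e8 1, e8 2] 7],
      0,
      ![0, 0, -(1 / 2) * Φ ![e8 0, e8 2] 2 + Φ ![e8 1, e8 2] 0, 0, 0, 0, 0, 0],
      ![0, 0, 0, -Φ ![e8 1, e8 4] 3, 0, 0, 0, 0],
      0,
      ![0, 0, 0, 0, 0, -Φ ![e8 1, e8 6] 5, 0, 0],
      0,
      ![-(1 / 2) * Φ ![e8 1, e8 7] 1, 0, 0, 0, 0, 0, 0, (1 / 2) * Φ ![e8 1, e8 7] 1 + Φ ![e8 4, e8 7] 4]])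
  refine ⟨Ψ, -2 * Φ ![e8 4, e8 5] 0, Φ ![e8 4, e8 7] 4 + Φ ![e8 5, e8 7] 5,
    alternating_ext_strictMono fun v hv => ?_⟩
  have hd : ∀ a b c l, dTwo Φ ![e8 a, e8 b, e8 c] l = 0 := fun a b c l => by rw [hΦ]; rfl
  have h017_1 := hd 0 1 7 1
  have h127_7 := hd 1 2 7 7
  have h012_0 := hd 0 1 2 0
  have h136_1 := hd 1 3 6 1
  have h145_1 := hd 1 4 5 1
  have h146_7 := hd 1 4 6 7
  have h236_2 := hd 2 3 6 2
  have h014_3 := hd 0 1 4 3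
  have h016_5 := hd 0 1 6 5
  have h127_0 := hd 1 2 7 0
  have h147_3 := hd 1 4 7 3
  have h167_5 := hd 1 6 7 5
  have h345_3 := hd 3 4 5 3
  have h123_3 := hd 1 2 3 3
  have h124_4 := hd 1 2 4 4
  have h125_5 := hd 1 2 5 5
  have h126_6 := hd 1 2 6 6
  simp only [dTwo_apply, brA_e8, multi_two_smul_left]
    at h017_1 h127_7 h012_0 h136_1 h145_1 h146_7 h236_2 h014_3 h016_5 h127_0 h147_3 h167_5 h345_3
       h123_3 h124_4 h125_5 h126_6
  simp only [brA_e8_zero, brA_e8_one, brA_e8_two, brA_e8_three, brA_e8_four, brA_e8_five,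
    brA_e8_six, brA_e8_seven, bracketCoeff, bracketIndex, alt_two_sort Φ, Fin.reduceLT,
    alt_two_self, Pi.add_apply, Pi.sub_apply,
    Pi.neg_apply, Pi.zero_apply, Pi.smul_apply, smul_eq_mul, Matrix.cons_val]
    at h017_1 h127_7 h012_0 h136_1 h145_1 h146_7 h236_2 h014_3 h016_5 h127_0 h147_3 h167_5 h345_3
       h123_3 h124_4 h125_5 h126_6
  push_cast at h017_1 h127_7 h012_0 h136_1 h145_1 h146_7 h236_2 h014_3 h016_5 h127_0 h147_3 h167_5
               h345_3 h123_3 h124_4 h125_5 h126_6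
  obtain ⟨i, j, rfl⟩ : ∃ i j, v = ![i, j] := ⟨v 0, v 1, by ext a; fin_cases a <;> rfl⟩
  have hij : i < j := hv (show (0 : Fin 2) < 1 by decide)
  rw [e8_comp_two]
  funext l
  rw [AlternatingMap.add_apply, AlternatingMap.add_apply, AlternatingMap.smul_apply,
    AlternatingMap.smul_apply, Pi.add_apply, Pi.add_apply, Pi.smul_apply, Pi.smul_apply, hΨ,
    phi1Alt_e8_apply, phi2Alt_e8_apply]
  split_ifs with hw
  · clear hd hΦ hΨ
    have hmem : (i, j, l) ∈
      [(0, 1, 1), (0, 2, 2), (0, 3, 3), (0, 4, 4), (0, 5, 5), (0, 6, 6), (0, 7, 0), (0, 7, 7),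
      (1, 2, 0), (1, 2, 7), (1, 4, 3), (1, 6, 5), (1, 7, 1), (2, 3, 4), (2, 5, 6), (2, 7, 2),
      (3, 5, 1), (3, 6, 0), (3, 6, 7), (3, 7, 3), (4, 5, 0), (4, 5, 7), (4, 6, 2), (4, 7, 4),
      (5, 7, 5), (6, 7, 6)] := by
      revert hw; revert hij; clear hv; revert i j l; decide +kernel
    simp only [dOne_apply, brA_e8, multi_one_smul, oneCochain_e8]
    simp only [List.mem_cons, Prod.mk.injEq, List.not_mem_nil, or_false] at hmem
    clear hw hij hv
    rcases hmem with
      ⟨rfl, rfl, rfl⟩ | ⟨rfl, rfl, rfl⟩ | ⟨rfl, rfl, rfl⟩ | ⟨rfl, rfl, rfl⟩ | ⟨rfl, rfl, rfl⟩ |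
      ⟨rfl, rfl, rfl⟩ | ⟨rfl, rfl, rfl⟩ | ⟨rfl, rfl, rfl⟩ | ⟨rfl, rfl, rfl⟩ | ⟨rfl, rfl, rfl⟩ |
      ⟨rfl, rfl, rfl⟩ | ⟨rfl, rfl, rfl⟩ | ⟨rfl, rfl, rfl⟩ | ⟨rfl, rfl, rfl⟩ | ⟨rfl, rfl, rfl⟩ |
      ⟨rfl, rfl, rfl⟩ | ⟨rfl, rfl, rfl⟩ | ⟨rfl, rfl, rfl⟩ | ⟨rfl, rfl, rfl⟩ | ⟨rfl, rfl, rfl⟩ |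
      ⟨rfl, rfl, rfl⟩ | ⟨rfl, rfl, rfl⟩ | ⟨rfl, rfl, rfl⟩ | ⟨rfl, rfl, rfl⟩ | ⟨rfl, rfl, rfl⟩ |
      ⟨rfl, rfl, rfl⟩
    all_goals
      simp only [brA_e8_zero, brA_e8_one, brA_e8_two, brA_e8_three, brA_e8_four, brA_e8_five,
        brA_e8_six, brA_e8_seven, bracketCoeff, bracketIndex, Pi.sub_apply, Pi.zero_apply,
        Pi.smul_apply, smul_eq_mul, Matrix.cons_val, phi1Int, phi2Int, Fin.coe_ofNat_eq_mod,
        Nat.reduceMod]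
      push_cast
    · linear_combination -h012_0
    · ring
    · linear_combination -(1 / 2) * h012_0 + (1 / 2) * h014_3 - (1 / 2) * h123_3 - (1 / 2) * h124_4
    · linear_combination (1 / 2) * h012_0 - (1 / 2) * h014_3 - (1 / 2) * h123_3 - (1 / 2) * h124_4
    · linear_combination -(1 / 2) * h012_0 + (1 / 2) * h016_5 - (1 / 2) * h125_5 - (1 / 2) * h126_6
    · linear_combination (1 / 2) * h012_0 - (1 / 2) * h016_5 - (1 / 2) * h125_5 - (1 / 2) * h126_6
    · linear_combination (1 / 2) * h017_1
    · linear_combination -h127_7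
    · ring
    · ring
    · ring
    · ring
    · ring
    · linear_combination -(1 / 2) * h012_0 + (1 / 2) * h014_3 + (1 / 2) * h123_3 - (1 / 2) * h124_4
    · linear_combination -(1 / 2) * h012_0 + (1 / 2) * h016_5 + (1 / 2) * h125_5 - (1 / 2) * h126_6
    · linear_combination (1 / 2) * h017_1 + h127_0
    · linear_combination -h145_1
    · linear_combination -(1 / 2) * h136_1 + (1 / 2) * h145_1
    · linear_combination -h145_1 - h146_7 - h345_3
    · linear_combination -h147_3
    · ring
    · linear_combination h145_1 + h345_3
    · linear_combination -h136_1 + h145_1 - h236_2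
    · ring
    · ring
    · linear_combination h167_5
  · have h1 : phi1Int i j l - phi1Int j i l = 0 := by
      revert hw; clear hij; revert i j l; decide +kernel
    have h2 : phi2Int i j l - phi2Int j i l = 0 := by
      revert hw; clear hij; revert i j l; decide +kernel
    simp [h1, h2]

set_option maxHeartbeats 4000000 in
/-- Every `3`-cocycle of `g_{-1}` is a combination of two explicit ones up to a coboundary. -/
lemma exists_eq_dTwo_add (Φ : V8 [⋀^Fin 3]→ₗ[ℝ] V8) (hΦ : dThree Φ = 0) :
    ∃ (Ψ : V8 [⋀^Fin 2]→ₗ[ℝ] V8) (s t : ℝ),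
      Φ = dTwo Ψ + s • threeCochain psi1Int + t • threeCochain psi2Int := by
  obtain ⟨Ψ, hΨ⟩ := exists_dTwo_eq Φ hΦ (twoCochain fun i j => match (i : ℕ), (j : ℕ) with
    | 0, 2 => (-Φ ![e8 0, e8 1, e8 2] 0) • e8 2
    | 0, 3 => (-(1 / 2) * Φ ![e8 1, e8 2, e8 3] 3 + (1 / 2) * Φ ![e8 0, e8 1, e8 4] 3 - (1 / 2) * Φ
      ![e8 1, e8 2, e8 4] 4) • e8 3
    | 0, 4 => (-(1 / 2) * Φ ![e8 1, e8 2, e8 3] 3 - (1 / 2) * Φ ![e8 0, e8 1, e8 4] 3 - (1 / 2) * Φ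
      ![e8 1, e8 2, e8 4] 4) • e8 4
    | 0, 5 => (-(1 / 2) * Φ ![e8 1, e8 2, e8 5] 5 + (1 / 2) * Φ ![e8 0, e8 1, e8 6] 5 - (1 / 2) * Φ
      ![e8 1, e8 2, e8 6] 6) • e8 5
    | 0, 6 => (-(1 / 2) * Φ ![e8 1, e8 2, e8 5] 5 - (1 / 2) * Φ ![e8 0, e8 1, e8 6] 5 - (1 / 2) * Φ
      ![e8 1, e8 2, e8 6] 6) • e8 6
    | 0, 7 => (-Φ ![e8 1, e8 2, e8 7] 7) • e8 7 + ((1 / 2) * Φ ![e8 0, e8 1, e8 7] 1) • e8 0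
    | 1, 6 => ((1 / 2) * Φ ![e8 1, e8 2, e8 5] 5 + (1 / 2) * Φ ![e8 0, e8 1, e8 6] 5 - (1 / 2) * Φ
      ![e8 1, e8 2, e8 6] 6) • e8 5
    | 2, 3 => ((1 / 2) * Φ ![e8 1, e8 2, e8 3] 3 + (1 / 2) * Φ ![e8 0, e8 1, e8 4] 3 - (1 / 2) * Φ
      ![e8 1, e8 2, e8 4] 4) • e8 4
    | 2, 7 => (Φ ![e8 1, e8 4, e8 7] 3 + Φ ![e8 2, e8 3, e8 7] 4) • e8 2
    | 3, 5 => (-Φ ![e8 1, e8 4, e8 5] 1) • e8 1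
    | 3, 6 => (Φ ![e8 2, e8 4, e8 5] 2 - Φ ![e8 2, e8 3, e8 5] 7 + Φ ![e8 4, e8 5, e8 6] 6) • e8 7 +
      (Φ ![e8 1, e8 4, e8 5] 1 - Φ ![e8 2, e8 3, e8 5] 0) • e8 0
    | 3, 7 => (-Φ ![e8 1, e8 4, e8 7] 3) • e8 3
    | 4, 5 => (-Φ ![e8 2, e8 4, e8 5] 2 - Φ ![e8 4, e8 5, e8 6] 6) • e8 7
    | 4, 6 => (-Φ ![e8 2, e8 4, e8 5] 2) • e8 2
    | 6, 7 => (Φ ![e8 1, e8 6, e8 7] 5) • e8 6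
    | _, _ => 0)
  refine ⟨Ψ, -(1 / 2) * Φ ![e8 4, e8 6, e8 7] 2, Φ ![e8 1, e8 4, e8 5] 1
    + Φ ![e8 2, e8 4, e8 5] 2 + Φ ![e8 3, e8 4, e8 5] 3
    + Φ ![e8 4, e8 5, e8 6] 6,
    alternating_ext_strictMono fun v hv => ?_⟩
  have hd : ∀ a b c d l, dThree Φ ![e8 a, e8 b, e8 c, e8 d] l = 0 := fun a b c d l => by
    rw [hΦ]; rfl
  have h0127_0 := hd 0 1 2 7 0
  have h0136_1 := hd 0 1 3 6 1
  have h0145_1 := hd 0 1 4 5 1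
  have h0146_7 := hd 0 1 4 6 7
  have h0236_2 := hd 0 2 3 6 2
  have h1367_1 := hd 1 3 6 7 1
  have h1457_1 := hd 1 4 5 7 1
  have h1467_7 := hd 1 4 6 7 7
  have h2367_2 := hd 2 3 6 7 2
  have h0147_3 := hd 0 1 4 7 3
  have h0167_5 := hd 0 1 6 7 5
  have h0345_3 := hd 0 3 4 5 3
  have h1236_7 := hd 1 2 3 6 7
  have h1245_7 := hd 1 2 4 5 7
  have h3457_3 := hd 3 4 5 7 3
  have h0123_3 := hd 0 1 2 3 3
  have h0124_4 := hd 0 1 2 4 4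
  have h0125_5 := hd 0 1 2 5 5
  have h1235_1 := hd 1 2 3 5 1
  have h1246_2 := hd 1 2 4 6 2
  have h1236_0 := hd 1 2 3 6 0
  have h1237_3 := hd 1 2 3 7 3
  have h1247_4 := hd 1 2 4 7 4
  have h1257_5 := hd 1 2 5 7 5
  have h1267_6 := hd 1 2 6 7 6
  have h1346_3 := hd 1 3 4 6 3
  have h1456_5 := hd 1 4 5 6 5
  simp only [dThree_apply, brA_e8, multi_three_smul_left]
    at h0127_0 h0136_1 h0145_1 h0146_7 h0236_2 h1367_1 h1457_1 h1467_7 h2367_2 h0147_3 h0167_5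
       h0345_3 h1236_7 h1245_7 h3457_3 h0123_3 h0124_4 h0125_5 h1235_1 h1246_2 h1236_0 h1237_3
       h1247_4 h1257_5 h1267_6 h1346_3 h1456_5
  simp only [brA_e8_zero, brA_e8_one, brA_e8_two, brA_e8_three, brA_e8_four, brA_e8_five,
    brA_e8_six, brA_e8_seven, bracketCoeff, bracketIndex, alt_three_sort_left Φ,
    alt_three_sort_right Φ, alt_three_left, alt_three_right, Fin.reduceLT,
    neg_neg, Pi.add_apply, Pi.sub_apply, Pi.neg_apply, Pi.zero_apply, Pi.smul_apply, smul_eq_mul,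
    Matrix.cons_val]
    at h0127_0 h0136_1 h0145_1 h0146_7 h0236_2 h1367_1 h1457_1 h1467_7 h2367_2 h0147_3 h0167_5
       h0345_3 h1236_7 h1245_7 h3457_3 h0123_3 h0124_4 h0125_5 h1235_1 h1246_2 h1236_0 h1237_3
       h1247_4 h1257_5 h1267_6 h1346_3 h1456_5
  push_cast at h0127_0 h0136_1 h0145_1 h0146_7 h0236_2 h1367_1 h1457_1 h1467_7 h2367_2 h0147_3
               h0167_5 h0345_3 h1236_7 h1245_7 h3457_3 h0123_3 h0124_4 h0125_5 h1235_1 h1246_2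
               h1236_0 h1237_3 h1247_4 h1257_5 h1267_6 h1346_3 h1456_5
  obtain ⟨i, j, k, rfl⟩ : ∃ i j k, v = ![i, j, k] :=
    ⟨v 0, v 1, v 2, by ext a; fin_cases a <;> rfl⟩
  have hij : i < j := hv (show (0 : Fin 3) < 1 by decide)
  have hjk : j < k := hv (show (1 : Fin 3) < 2 by decide)
  rw [e8_comp_three]
  funext l
  rw [AlternatingMap.add_apply, AlternatingMap.add_apply, AlternatingMap.smul_apply,
    AlternatingMap.smul_apply, Pi.add_apply, Pi.add_apply, Pi.smul_apply, Pi.smul_apply, hΨ,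
    threeCochain_e8, threeCochain_e8]
  clear hd hΦ hΨ hv
  split_ifs with hw
  · have hmem : (i, j, k, l) ∈
      [(0, 1, 2, 0), (0, 1, 2, 7), (0, 1, 4, 3), (0, 1, 6, 5), (0, 1, 7, 1), (0, 2, 3, 4),
      (0, 2, 5, 6), (0, 2, 7, 2), (0, 3, 5, 1), (0, 3, 6, 0), (0, 3, 6, 7), (0, 3, 7, 3),
      (0, 4, 5, 0), (0, 4, 5, 7), (0, 4, 6, 2), (0, 4, 7, 4), (0, 5, 7, 5), (0, 6, 7, 6),
      (1, 2, 3, 3), (1, 2, 4, 4), (1, 2, 5, 5), (1, 2, 6, 6), (1, 2, 7, 0), (1, 2, 7, 7),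
      (1, 3, 6, 1), (1, 4, 5, 1), (1, 4, 6, 0), (1, 4, 6, 7), (1, 4, 7, 3), (1, 6, 7, 5),
      (2, 3, 5, 0), (2, 3, 5, 7), (2, 3, 6, 2), (2, 3, 7, 4), (2, 4, 5, 2), (2, 5, 7, 6),
      (3, 4, 5, 3), (3, 4, 6, 4), (3, 5, 6, 5), (3, 5, 7, 1), (3, 6, 7, 0), (3, 6, 7, 7),
      (4, 5, 6, 6), (4, 5, 7, 0), (4, 5, 7, 7), (4, 6, 7, 2)] := by
      revert hw hjk hij; revert i j k l; decide +kernel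
    simp only [dTwo_apply, brA_e8, multi_two_smul_left, twoCochain_e8]
    simp only [List.mem_cons, Prod.mk.injEq, List.not_mem_nil, or_false] at hmem
    clear hw hij hjk
    rcases hmem with
      ⟨rfl, rfl, rfl, rfl⟩ | ⟨rfl, rfl, rfl, rfl⟩ | ⟨rfl, rfl, rfl, rfl⟩ | ⟨rfl, rfl, rfl, rfl⟩ |
      ⟨rfl, rfl, rfl, rfl⟩ | ⟨rfl, rfl, rfl, rfl⟩ | ⟨rfl, rfl, rfl, rfl⟩ | ⟨rfl, rfl, rfl, rfl⟩ |
      ⟨rfl, rfl, rfl, rfl⟩ | ⟨rfl, rfl, rfl, rfl⟩ | ⟨rfl, rfl, rfl, rfl⟩ | ⟨rfl, rfl, rfl, rfl⟩ |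
      ⟨rfl, rfl, rfl, rfl⟩ | ⟨rfl, rfl, rfl, rfl⟩ | ⟨rfl, rfl, rfl, rfl⟩ | ⟨rfl, rfl, rfl, rfl⟩ |
      ⟨rfl, rfl, rfl, rfl⟩ | ⟨rfl, rfl, rfl, rfl⟩ | ⟨rfl, rfl, rfl, rfl⟩ | ⟨rfl, rfl, rfl, rfl⟩ |
      ⟨rfl, rfl, rfl, rfl⟩ | ⟨rfl, rfl, rfl, rfl⟩ | ⟨rfl, rfl, rfl, rfl⟩ | ⟨rfl, rfl, rfl, rfl⟩ |
      ⟨rfl, rfl, rfl, rfl⟩ | ⟨rfl, rfl, rfl, rfl⟩ | ⟨rfl, rfl, rfl, rfl⟩ | ⟨rfl, rfl, rfl, rfl⟩ |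
      ⟨rfl, rfl, rfl, rfl⟩ | ⟨rfl, rfl, rfl, rfl⟩ | ⟨rfl, rfl, rfl, rfl⟩ | ⟨rfl, rfl, rfl, rfl⟩ |
      ⟨rfl, rfl, rfl, rfl⟩ | ⟨rfl, rfl, rfl, rfl⟩ | ⟨rfl, rfl, rfl, rfl⟩ | ⟨rfl, rfl, rfl, rfl⟩ |
      ⟨rfl, rfl, rfl, rfl⟩ | ⟨rfl, rfl, rfl, rfl⟩ | ⟨rfl, rfl, rfl, rfl⟩ | ⟨rfl, rfl, rfl, rfl⟩ |
      ⟨rfl, rfl, rfl, rfl⟩ | ⟨rfl, rfl, rfl, rfl⟩ | ⟨rfl, rfl, rfl, rfl⟩ | ⟨rfl, rfl, rfl, rfl⟩ |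
      ⟨rfl, rfl, rfl, rfl⟩ | ⟨rfl, rfl, rfl, rfl⟩
    all_goals
      simp only [brA_e8_zero, brA_e8_one, brA_e8_two, brA_e8_three, brA_e8_four, brA_e8_five,
        brA_e8_six, brA_e8_seven, bracketCoeff, bracketIndex, Pi.add_apply, Pi.sub_apply,
        Pi.zero_apply, Pi.smul_apply, smul_eq_mul, Matrix.cons_val, antisymmetrize, psi1Int,
        psi2Int, phi1Int, Fin.coe_ofNat_eq_mod, Nat.reduceMod, e8, Fin.reduceEq, reduceIte]
      push_cast
    · ring
    · linear_combination -(1 / 2) * h0123_3 - (1 / 2) * h0124_4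
    · ring
    · ring
    · ring
    · linear_combination -(1 / 2) * h0123_3 + (1 / 2) * h0124_4
    · linear_combination -(1 / 2) * h0123_3 - (1 / 2) * h0124_4 - h0125_5
    · linear_combination -h0127_0
    · linear_combination (1 / 3) * h0145_1 - (1 / 3) * h0146_7 - (2 / 3) * h0345_3 - (1 / 3) *
        h1236_7 + (1 / 3) * h1245_7
    · linear_combination (1 / 2) * h0136_1 - (1 / 6) * h0145_1 + (1 / 6) * h0146_7 + (1 / 3) *
        h0345_3 + (1 / 6) * h1236_7 - (1 / 6) * h1245_7
    · linear_combination (1 / 2) * h0146_7 - (1 / 2) * h1236_7 + (1 / 2) * h1245_7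
    · linear_combination (1 / 2) * h0147_3 - (1 / 2) * h1237_3 - (1 / 2) * h1247_4
    · linear_combination (1 / 3) * h0145_1 + (1 / 6) * h0146_7 + (1 / 3) * h0345_3 + (1 / 6) *
        h1236_7 - (1 / 6) * h1245_7
    · linear_combination (1 / 2) * h0146_7 + (1 / 2) * h1236_7 - (1 / 2) * h1245_7
    · linear_combination h0136_1 - (1 / 3) * h0145_1 + (1 / 3) * h0146_7 + h0236_2 + (2 / 3) *
        h0345_3 + (1 / 3) * h1236_7 - (1 / 3) * h1245_7
    · linear_combination -(1 / 2) * h0147_3 - (1 / 2) * h1237_3 - (1 / 2) * h1247_4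
    · linear_combination (1 / 2) * h0167_5 - (1 / 2) * h1257_5 - (1 / 2) * h1267_6
    · linear_combination -(1 / 2) * h0167_5 - (1 / 2) * h1257_5 - (1 / 2) * h1267_6
    · ring
    · ring
    · ring
    · ring
    · linear_combination -(1 / 2) * h0147_3 - (1 / 2) * h1237_3 + (1 / 2) * h1247_4
    · ring
    · linear_combination (1 / 3) * h0145_1 - (1 / 3) * h0146_7 - (2 / 3) * h0345_3 - (1 / 3) *
        h1236_7 + (1 / 3) * h1245_7 + h1235_1
    · ring
    · linear_combination -(3 / 2) * h0136_1 + (5 / 6) * h0145_1 - (5 / 6) * h0146_7 - h0236_2 -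
        (5 / 3) * h0345_3 - (5 / 6) * h1236_7 + (5 / 6) * h1245_7 + h1235_1 - h1246_2 - h1236_0
    · linear_combination (1 / 2) * h0146_7 + (1 / 2) * h1236_7 + (1 / 2) * h1245_7
    · ring
    · ring
    · ring
    · ring
    · linear_combination 2 * h0136_1 - (4 / 3) * h0145_1 + (4 / 3) * h0146_7 + h0236_2 + (8 / 3)
        * h0345_3 + (4 / 3) * h1236_7 - (4 / 3) * h1245_7 - 2 * h1235_1 + h1246_2 + 2 * h1236_0
    · ring
    · ring
    · linear_combination -(1 / 2) * h0147_3 + (1 / 2) * h0167_5 - (1 / 2) * h1237_3 + (1 / 2) *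
        h1247_4 + (1 / 2) * h1257_5 - (1 / 2) * h1267_6
    · ring
    · linear_combination (3 / 2) * h0136_1 - (1 / 2) * h0145_1 + h0146_7 + h0236_2 + h0345_3 +
        h1236_7 + h1246_2 + h1236_0 + h1346_3
    · linear_combination (3 / 2) * h0136_1 - (5 / 6) * h0145_1 + (1 / 3) * h0146_7 + h0236_2 +
        (5 / 3) * h0345_3 + (1 / 3) * h1236_7 - (4 / 3) * h1245_7 - h1235_1 + h1246_2 + h1236_0 -
        h1456_5
    · linear_combination -h1367_1 - h2367_2
    · linear_combination (1 / 2) * h2367_2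
    · linear_combination -(3 / 2) * h1367_1 + (1 / 2) * h1457_1 - h1467_7 - (3 / 2) * h2367_2 -
        h3457_3
    · ring
    · linear_combination (1 / 2) * h1367_1 - (1 / 2) * h1457_1 + (1 / 2) * h2367_2
    · linear_combination (3 / 2) * h1367_1 - (1 / 2) * h1457_1 + (3 / 2) * h2367_2 + h3457_3
    · ring
  · have h1 : antisymmetrize psi1Int i j k l = 0 := by
      revert hw; clear hij hjk; revert i j k l; decide +kernel
    have h2 : antisymmetrize psi2Int i j k l = 0 := by
      revert hw; clear hij hjk; revert i j k l; decide +kernel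
    simp [h1, h2]

lemma mem_ceZ_two (Φ : V8 [⋀^Fin 2]→ₗ[ℝ] V8) :
    Φ ∈ ceZ (brA (-1)) (brA (-1)) 2 ↔ dTwo Φ = 0 :=
  ⟨fun h => AlternatingMap.ext fun X => congrFun (LinearMap.mem_ker.mp h) X,
    fun h => LinearMap.mem_ker.mpr (funext fun X => congrArg (fun T => T X) h)⟩

lemma mem_ceZ_three (Φ : V8 [⋀^Fin 3]→ₗ[ℝ] V8) :
    Φ ∈ ceZ (brA (-1)) (brA (-1)) 3 ↔ dThree Φ = 0 :=
  ⟨fun h => AlternatingMap.ext fun X => congrFun (LinearMap.mem_ker.mp h) X,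
    fun h => LinearMap.mem_ker.mpr (funext fun X => congrArg (fun T => T X) h)⟩

lemma mem_ceB_two (Φ : V8 [⋀^Fin 2]→ₗ[ℝ] V8) :
    Φ ∈ ceB (brA (-1)) (brA (-1)) 2 ↔ ∃ Ψ, dOne Ψ = Φ :=
  exists_congr fun _ => ⟨fun h => AlternatingMap.ext (congrFun h),
    fun h => funext fun X => congrArg (fun T => T X) h⟩

lemma mem_ceB_three (Φ : V8 [⋀^Fin 3]→ₗ[ℝ] V8) :
    Φ ∈ ceB (brA (-1)) (brA (-1)) 3 ↔ ∃ Ψ, dTwo Ψ = Φ :=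
  exists_congr fun _ => ⟨fun h => AlternatingMap.ext (congrFun h),
    fun h => funext fun X => congrArg (fun T => T X) h⟩

/-- `φ₁` and `φ₂` are linearly independent modulo coboundaries. -/
lemma eq_zero_of_dOne_eq (Ψ : V8 [⋀^Fin 1]→ₗ[ℝ] V8) (s t : ℝ)
    (h : dOne Ψ = s • phi1Alt + t • phi2Alt) : s = 0 ∧ t = 0 := by
  have hv : ∀ i j l, dOne Ψ ![e8 i, e8 j] l =
      s * phi1Alt ![e8 i, e8 j] l + t * phi2Alt ![e8 i, e8 j] l := fun i j l => by rw [h]; rfl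
  have h450 := hv 4 5 0
  have h474 := hv 4 7 4
  have h575 := hv 5 7 5
  simp only [dOne_apply, brA_e8, multi_one_smul, phi1Alt_e8_apply, phi2Alt_e8_apply]
    at h450 h474 h575
  simp only [brA_e8_four, brA_e8_five, brA_e8_seven, bracketCoeff, bracketIndex, Pi.sub_apply,
    Pi.smul_apply, smul_eq_mul, Matrix.cons_val, phi1Int, phi2Int, Fin.coe_ofNat_eq_mod,
    Nat.reduceMod] at h450 h474 h575
  push_cast at h450 h474 h575
  constructor <;> linarith

/-- The two explicit `3`-cocycles are linearly independent modulo coboundaries. -/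
lemma eq_zero_of_dTwo_eq (Ψ : V8 [⋀^Fin 2]→ₗ[ℝ] V8) (s t : ℝ)
    (h : dTwo Ψ = s • threeCochain psi1Int + t • threeCochain psi2Int) : s = 0 ∧ t = 0 := by
  have hv : ∀ i j k l, dTwo Ψ ![e8 i, e8 j, e8 k] l =
      s * threeCochain psi1Int ![e8 i, e8 j, e8 k] l
        + t * threeCochain psi2Int ![e8 i, e8 j, e8 k] l := fun i j k l => by rw [h]; rfl
  have h4672 := hv 4 6 7 2
  have h1451 := hv 1 4 5 1
  have h2452 := hv 2 4 5 2
  have h3453 := hv 3 4 5 3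
  have h4566 := hv 4 5 6 6
  simp only [dTwo_apply, brA_e8, multi_two_smul_left, threeCochain_e8]
    at h4672 h1451 h2452 h3453 h4566
  simp only [brA_e8_one, brA_e8_two, brA_e8_three, brA_e8_four, brA_e8_five, brA_e8_six,
    brA_e8_seven, bracketCoeff, bracketIndex, alt_two_sort Ψ, Fin.reduceLT, Pi.add_apply,
    Pi.sub_apply, Pi.neg_apply, Pi.smul_apply, smul_eq_mul, Matrix.cons_val, antisymmetrize, psi1Int, psi2Int, phi1Int,
    Fin.coe_ofNat_eq_mod, Nat.reduceMod, Fin.reduceEq, reduceIte]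
    at h4672 h1451 h2452 h3453 h4566
  push_cast at h4672 h1451 h2452 h3453 h4566
  constructor <;> linarith

namespace CE

/-- If two cocycles are linearly independent modulo coboundaries and generate all cocycles modulo
coboundaries, then their classes form a basis of the cohomology. -/
lemma classes_pair_basis {V W : Type} [AddCommGroup V] [Module ℝ V] [AddCommGroup W] [Module ℝ W]
    (br : V →ₗ[ℝ] V →ₗ[ℝ] V) (ρ : V →ₗ[ℝ] W →ₗ[ℝ] W) (p : ℕ) (a b : ceZ br ρ p)
    (hli : ∀ s t : ℝ, s • (a : V [⋀^Fin p]→ₗ[ℝ] W) + t • (b : V [⋀^Fin p]→ₗ[ℝ] W) ∈ ceB br ρ p →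
      s = 0 ∧ t = 0)
    (hsp : ∀ z ∈ ceZ br ρ p, ∃ s t : ℝ, z - (s • (a : V [⋀^Fin p]→ₗ[ℝ] W)
      + t • (b : V [⋀^Fin p]→ₗ[ℝ] W)) ∈ ceB br ρ p) :
    LinearIndependent ℝ ![CEHcls br ρ p a, CEHcls br ρ p b] ∧
    Submodule.span ℝ {CEHcls br ρ p a, CEHcls br ρ p b} = ⊤ ∧ Hdim br ρ p = 2 := by
  set N := Submodule.comap (ceZ br ρ p).subtype (ceB br ρ p) with hN
  have hind : LinearIndependent ℝ ![CEHcls br ρ p a, CEHcls br ρ p b] := by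
    rw [LinearIndependent.pair_iff]
    intro s t h
    exact hli s t ((Submodule.Quotient.mk_eq_zero N (x := s • a + t • b)).mp h)
  have hspan : Submodule.span ℝ {CEHcls br ρ p a, CEHcls br ρ p b} = ⊤ := by
    rw [eq_top_iff]
    intro c _
    obtain ⟨z, rfl⟩ := Submodule.mkQ_surjective N c
    obtain ⟨s, t, h⟩ := hsp z z.2
    refine Submodule.mem_span_pair.mpr ⟨s, t, ?_⟩
    exact ((Submodule.Quotient.eq N (x := z) (y := s • a + t • b)).mpr h).symm
  refine ⟨hind, hspan, ?_⟩
  have := finrank_span_eq_card hind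
  rw [Matrix.range_cons_cons_empty, hspan, finrank_top] at this
  simpa [Hdim] using this

end CE

/-- The classes of `φ₁` and `φ₂` form a basis of `H²(g_{-1}, g_{-1})`. -/
lemma classes_phi1Alt_phi2Alt :
    LinearIndependent ℝ
      ![CEHcls (brA (-1)) (brA (-1)) 2 ⟨phi1Alt, (mem_ceZ_two _).mpr dTwo_phi1Alt⟩,
        CEHcls (brA (-1)) (brA (-1)) 2 ⟨phi2Alt, (mem_ceZ_two _).mpr dTwo_phi2Alt⟩] ∧
    Submodule.span ℝ
      {CEHcls (brA (-1)) (brA (-1)) 2 ⟨phi1Alt, (mem_ceZ_two _).mpr dTwo_phi1Alt⟩,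
        CEHcls (brA (-1)) (brA (-1)) 2 ⟨phi2Alt, (mem_ceZ_two _).mpr dTwo_phi2Alt⟩} = ⊤ ∧
    Hdim (brA (-1)) (brA (-1)) 2 = 2 := by
  refine classes_pair_basis _ _ 2 _ _ (fun s t h => ?_) (fun z hz => ?_)
  · obtain ⟨Ψ, hΨ⟩ := (mem_ceB_two _).mp h
    exact eq_zero_of_dOne_eq Ψ s t hΨ
  · obtain ⟨Ψ, s, t, h⟩ := exists_eq_dOne_add z ((mem_ceZ_two z).mp hz)
    exact ⟨s, t, (mem_ceB_two _).mpr ⟨Ψ, by rw [h]; abel⟩⟩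

lemma Hdim_three : Hdim (brA (-1)) (brA (-1)) 3 = 2 := by
  refine (classes_pair_basis _ _ 3 ⟨_, (mem_ceZ_three _).mpr dThree_psi1⟩
    ⟨_, (mem_ceZ_three _).mpr dThree_psi2⟩ (fun s t h => ?_) (fun z hz => ?_)).2.2
  · obtain ⟨Ψ, hΨ⟩ := (mem_ceB_three _).mp h
    exact eq_zero_of_dTwo_eq Ψ s t hΨ
  · obtain ⟨Ψ, s, t, h⟩ := exists_eq_dTwo_add z ((mem_ceZ_three z).mp hz)
    exact ⟨s, t, (mem_ceB_three _).mpr ⟨Ψ, by rw [h]; abel⟩⟩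

open CE in
/-- `dim H²(g_{−1}, g_{−1}) = 2`, with the classes of the cocycles `φ₁` and `φ₂`
forming a basis, and `dim H³(g_{−1}, g_{−1}) = 2` (adjoint coefficients). -/
theorem adjoint_cohomology_of_g_minus_one :
    Hdim (brA (-1)) (brA (-1)) 2 = 2 ∧
    (∃ (m1 : phi1Alt ∈ ceZ (brA (-1)) (brA (-1)) 2)
       (m2 : phi2Alt ∈ ceZ (brA (-1)) (brA (-1)) 2),
      LinearIndependent ℝ
        ![CEHcls (brA (-1)) (brA (-1)) 2 ⟨phi1Alt, m1⟩,
          CEHcls (brA (-1)) (brA (-1)) 2 ⟨phi2Alt, m2⟩] ∧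
      Submodule.span ℝ
        {CEHcls (brA (-1)) (brA (-1)) 2 ⟨phi1Alt, m1⟩,
         CEHcls (brA (-1)) (brA (-1)) 2 ⟨phi2Alt, m2⟩} = ⊤) ∧
    Hdim (brA (-1)) (brA (-1)) 3 = 2 := by
  obtain ⟨hli, hspan, hdim⟩ := classes_phi1Alt_phi2Alt
  exact ⟨hdim, ⟨_, _, hli, hspan⟩, Hdim_three⟩
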